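/- arXiv:1901.04325 — 2 statements merged into one kernel-verified Lean document; each statement's English description precedes it below -/
import Mathlib

section
/- For every k ≥ 1, the Disjoint Paths Problem instance G_k,(s_1,t_1),…,(s_k,t_k) has exactly one solution: if P_1,…,P_k and P'_1,…,P'_k are both solutions, then P_i = P'_i (as subgraphs) for every i ∈ [k]. -/
open SimpleGraph

/-- `P` is a solution of the Disjoint Paths Problem instance `G, (s 0, t 0), …, (s (k-1), t (k-1))`:
the walks `P i` are paths, `P i` connects `s i` to `t i`, and they are pairwise vertex-disjoint. -/
def IsDPPSolution {V : Type*} (G : SimpleGraph V) {k : ℕ} {s t : Fin k → V}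
    (P : (i : Fin k) → G.Walk (s i) (t i)) : Prop :=
  (∀ i, (P i).IsPath) ∧
    ∀ i j : Fin k, i ≠ j → ∀ v, v ∈ (P i).support → v ∉ (P j).support

/-- The Disjoint Paths Problem instance `G, (s 0, t 0), …, (s (k-1), t (k-1))` has a solution. -/
def HasDPPSolution {V : Type*} (G : SimpleGraph V) (k : ℕ) (s t : Fin k → V) : Prop :=
  ∃ P : (i : Fin k) → G.Walk (s i) (t i), IsDPPSolution G P

/-- Data of a graph together with its top row, bottom row and terminals `s`, `t`
(indexed by `ℕ`; index `i` stands for the terminal pair `(s_{i+1}, t_{i+1})`). -/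
structure RowedGraph (p : ℕ) where
  V : Type
  G : SimpleGraph V
  top : Fin p → V
  bot : Fin p → V
  s : ℕ → V
  t : ℕ → V

/-- The instance `G_{1,p}`: a path `x_1, …, x_p` on `p` vertices, with `s_1 = x_1`,
`t_1 = x_p`, and top and bottom row both equal to `x_1, …, x_p`. -/
def baseRG (p : ℕ) (hp : 0 < p) : RowedGraph p where
  V := Fin p
  G := SimpleGraph.fromRel fun i j => i.val + 1 = j.val
  top := id
  bot := id
  s := fun _ => ⟨0, hp⟩
  t := fun _ => ⟨p - 1, by omega⟩

/-- The step of the construction: `G_{k+1,p}` is obtained from `R = G_{k,2p}` (with bottom row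
`x_1, …, x_{2p}` and top row `z_1, …, z_{2p}`) by adding a new path `y_1, …, y_p` together with
the edges `{y_i, x_i}` and `{y_i, x_{2p-i+1}}`; the new terminal pair is `s_{k+1} = y_1`,
`t_{k+1} = y_p`; the new top row is `z_1, …, z_p` and the new bottom row is `z_{2p}, …, z_{p+1}`.
(Here `k` is the number of terminal pairs of `R`, and everything is 0-indexed.) -/
def stepRG (k : ℕ) {p : ℕ} (hp : 0 < p) (R : RowedGraph (2 * p)) : RowedGraph p where
  V := R.V ⊕ Fin p
  G := SimpleGraph.fromRel fun a b =>
    match a, b with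
    | Sum.inl u, Sum.inl v => R.G.Adj u v
    | Sum.inr i, Sum.inr j => i.val + 1 = j.val
    | Sum.inr i, Sum.inl v =>
        v = R.bot ⟨i.val, by have := i.isLt; omega⟩ ∨
        v = R.bot ⟨2 * p - 1 - i.val, by have := i.isLt; omega⟩
    | Sum.inl _, Sum.inr _ => False
  top := fun i => Sum.inl (R.top ⟨i.val, by have := i.isLt; omega⟩)
  bot := fun i => Sum.inl (R.top ⟨2 * p - 1 - i.val, by have := i.isLt; omega⟩)
  s := fun i => if i < k then Sum.inl (R.s i) else Sum.inr ⟨0, hp⟩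
  t := fun i => if i < k then Sum.inl (R.t i) else Sum.inr ⟨p - 1, by omega⟩

/-- `GP k p hp` is the instance `G_{k+1,p}` of the paper (so the paper's `G_{k,p}`, `k ≥ 1`,
is `GP (k-1) p hp`), together with its rows and terminals. -/
def GP : (k p : ℕ) → 0 < p → RowedGraph p
  | 0, p, hp => baseRG p hp
  | k + 1, p, hp => stepRG (k + 1) hp (GP k (2 * p) (by omega))

lemma two_pow_sub_one_pos {k : ℕ} (hk : 1 ≤ k) : 0 < 2 ^ k - 1 := by
  have h2 : 2 ^ 1 ≤ 2 ^ k := Nat.pow_le_pow_right (by norm_num) hk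
  simp only [pow_one] at h2
  omega

/-- Words over `ℕ` without two equal consecutive letters: the reduced words of the free product of
countably many groups of order two. -/
def ReducedWord : Type := {l : List ℕ // l.IsChain (· ≠ ·)}

namespace ReducedWord

/-- Left multiplication of a word by a letter, with cancellation. -/
def push (j : ℕ) : List ℕ → List ℕ
  | [] => [j]
  | a :: l => if a = j then l else j :: a :: l

lemma isChain_push (j : ℕ) {l : List ℕ} (h : l.IsChain (· ≠ ·)) :
    (push j l).IsChain (· ≠ ·) := by
  cases l with
  | nil => simp [push]
  | cons a l =>
    by_cases hj : a = j
    · simpa [push, hj] using h.tail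
    · simp only [push, hj, if_false, List.isChain_cons_cons]
      exact ⟨Ne.symm hj, h⟩

lemma push_push (j : ℕ) {l : List ℕ} (h : l.IsChain (· ≠ ·)) : push j (push j l) = l := by
  match l with
  | [] => simp [push]
  | [a] =>
    by_cases hj : a = j <;> simp [push, hj]
  | a :: b :: l =>
    have hab : a ≠ b := (List.isChain_cons_cons.1 h).1
    by_cases hj : a = j
    · subst hj
      simp [push, hab.symm]
    · simp [push, hj]

lemma push_of_isChain {j : ℕ} {l : List ℕ} (h : (j :: l).IsChain (· ≠ ·)) :
    push j l = j :: l := by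
  cases l with
  | nil => rfl
  | cons a l =>
    have := (List.isChain_cons_cons.1 h).1
    simp [push, this.symm]

lemma push_length_le (j : ℕ) (l : List ℕ) : (push j l).length ≤ l.length + 1 := by
  cases l with
  | nil => simp [push]
  | cons a l =>
    simp only [push]
    split <;> simp only [List.length_cons] <;> omega

lemma push_of_length_eq {j : ℕ} {l : List ℕ} (h : (push j l).length = l.length + 1) :
    push j l = j :: l := by
  cases l with
  | nil => rfl
  | cons a l =>
    simp only [push] at h ⊢
    split_ifs at h ⊢
    · simp at h
      omega
    · rfl

/-- A letter, acting as an involution on the reduced words. -/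
def letter (j : ℕ) : Equiv.Perm ReducedWord :=
  Function.Involutive.toPerm (fun w => ⟨push j w.1, isChain_push j w.2⟩)
    fun w => Subtype.ext (push_push j w.2)

lemma letter_apply (j : ℕ) (w : ReducedWord) : (letter j w).1 = push j w.1 := rfl

lemma letter_mul_self (j : ℕ) : letter j * letter j = 1 := by
  ext1 w
  exact Subtype.ext (push_push j w.2)

/-- A letter up to `m`, acting on the reduced words; larger letters are trivial. -/
def letterUpTo (m j : ℕ) : Equiv.Perm ReducedWord := if j ≤ m then letter j else 1

lemma letterUpTo_of_le {m j : ℕ} (h : j ≤ m) : letterUpTo m j = letter j := if_pos h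

lemma letterUpTo_of_lt {m j : ℕ} (h : m < j) : letterUpTo m j = 1 := if_neg h.not_ge

lemma letterUpTo_mul_self (m j : ℕ) : letterUpTo m j * letterUpTo m j = 1 := by
  unfold letterUpTo
  split
  · exact letter_mul_self j
  · simp

/-- The empty word. -/
def empty : ReducedWord := ⟨[], by simp⟩

end ReducedWord

/-- The value of an optional letter in a group. -/
def optVal {Γ : Type*} [Group Γ] (φ : ℕ → Γ) (o : Option ℕ) : Γ := o.elim 1 φ

/-- The value of a word of optional letters in a group. -/
def wordVal {Γ : Type*} [Group Γ] (φ : ℕ → Γ) (l : List (Option ℕ)) : Γ :=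
  (l.map (optVal φ)).prod

section wordVal

variable {Γ : Type*} [Group Γ] {φ : ℕ → Γ}

lemma optVal_mul_self (hφ : ∀ j, φ j * φ j = 1) (o : Option ℕ) :
    optVal φ o * optVal φ o = 1 := by
  cases o <;> simp [optVal, hφ]

lemma optVal_inv (hφ : ∀ j, φ j * φ j = 1) (o : Option ℕ) : (optVal φ o)⁻¹ = optVal φ o :=
  inv_eq_of_mul_eq_one_left (optVal_mul_self hφ o)

lemma wordVal_append (l l' : List (Option ℕ)) :
    wordVal φ (l ++ l') = wordVal φ l * wordVal φ l' := by
  simp [wordVal]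

lemma wordVal_cons (o : Option ℕ) (l : List (Option ℕ)) :
    wordVal φ (o :: l) = optVal φ o * wordVal φ l := by
  simp [wordVal]

lemma wordVal_singleton (o : Option ℕ) : wordVal φ [o] = optVal φ o := by
  simp [wordVal]

lemma wordVal_reverse (hφ : ∀ j, φ j * φ j = 1) (l : List (Option ℕ)) :
    wordVal φ l.reverse = (wordVal φ l)⁻¹ := by
  induction l with
  | nil => simp [wordVal]
  | cons o l ih =>
    rw [List.reverse_cons, wordVal_append, wordVal_singleton, ih, wordVal_cons, mul_inv_rev,
      optVal_inv hφ]

end wordVal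

open ReducedWord in
lemma wordVal_letterUpTo_length_le (m : ℕ) (l : List (Option ℕ)) :
    (wordVal (letterUpTo m) l empty).1.length ≤ l.length ∧
      ((wordVal (letterUpTo m) l empty).1.length = l.length →
        l = (wordVal (letterUpTo m) l empty).1.map some) := by
  induction l with
  | nil => exact ⟨le_rfl, fun _ => rfl⟩
  | cons o l ih =>
    rw [wordVal_cons, Equiv.Perm.mul_apply]
    generalize wordVal (letterUpTo m) l empty = w at ih ⊢
    by_cases ho : ∃ j ≤ m, o = some j
    · obtain ⟨j, hj, rfl⟩ := ho
      have h : (optVal (letterUpTo m) (some j) w).1 = push j w.1 := by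
        simp [optVal, letterUpTo_of_le hj, letter_apply]
      rw [h]
      have hle := push_length_le j w.1
      refine ⟨by simp only [List.length_cons]; omega, fun heq => ?_⟩
      simp only [List.length_cons] at heq
      have hw : w.1.length = l.length := by omega
      rw [push_of_length_eq (by omega), List.map_cons, ← ih.2 hw]
    · have h : optVal (letterUpTo m) o = 1 := by
        cases o with
        | none => rfl
        | some j =>
          have : ¬ j ≤ m := fun hj => ho ⟨j, hj, rfl⟩
          simp [optVal, letterUpTo, this]
      rw [h, Equiv.Perm.one_apply]
      refine ⟨by simp only [List.length_cons]; omega, fun heq => ?_⟩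
      simp only [List.length_cons] at heq
      omega

open ReducedWord in
lemma wordVal_letterUpTo_of_isChain {m : ℕ} {r : List ℕ} (hr : r.IsChain (· ≠ ·))
    (hm : ∀ j ∈ r, j ≤ m) : (wordVal (letterUpTo m) (r.map some) empty).1 = r := by
  induction r with
  | nil => rfl
  | cons j r ih =>
    have ih' := ih hr.tail fun i hi => hm i (List.mem_cons_of_mem _ hi)
    have hj : j ≤ m := hm j List.mem_cons_self
    rw [List.map_cons, wordVal_cons, Equiv.Perm.mul_apply]
    generalize wordVal (letterUpTo m) (r.map some) empty = w at ih' ⊢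
    have h : (optVal (letterUpTo m) (some j) w).1 = push j w.1 := by
      simp [optVal, letterUpTo_of_le hj, letter_apply]
    rw [h, ih', push_of_isChain hr]

open ReducedWord in
/-- A word that is not longer than a reduced word of the same value equals it. -/
lemma eq_map_some_of_wordVal_eq {m : ℕ} {r : List ℕ} {l : List (Option ℕ)}
    (hr : r.IsChain (· ≠ ·)) (hm : ∀ j ∈ r, j ≤ m) (hl : l.length = r.length)
    (h : wordVal (letterUpTo m) l = wordVal (letterUpTo m) (r.map some)) : l = r.map some := by
  have h1 := wordVal_letterUpTo_of_isChain hr hm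
  rw [← h] at h1
  have h2 := (wordVal_letterUpTo_length_le m l).2
  rw [h1] at h2
  exact h2 hl.symm

/-- The word `0 1 0 2 0 1 0 3 …` of length `2 ^ (k + 1) - 1`. -/
def ruler : ℕ → List ℕ
  | 0 => [0]
  | k + 1 => ruler k ++ [k + 1] ++ (ruler k).reverse

lemma le_of_mem_ruler {k j : ℕ} (h : j ∈ ruler k) : j ≤ k := by
  induction k with
  | zero => simp_all [ruler]
  | succ k ih =>
    simp only [ruler, List.mem_append, List.mem_singleton, List.mem_reverse] at h
    rcases h with (h | h) | h
    · exact (ih h).trans k.le_succ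
    · exact h.le
    · exact (ih h).trans k.le_succ

lemma isChain_ruler (k : ℕ) : (ruler k).IsChain (· ≠ ·) := by
  induction k with
  | zero => simp [ruler]
  | succ k ih =>
    have hrev : (ruler k).reverse.IsChain (· ≠ ·) := by
      rw [List.isChain_reverse]
      exact ih.imp fun _ _ h => h.symm
    rw [ruler, List.append_assoc, List.isChain_append]
    refine ⟨ih, ?_, ?_⟩
    · rw [List.isChain_append]
      refine ⟨by simp, hrev, fun x hx y hy => ?_⟩
      have := le_of_mem_ruler (List.mem_reverse.1 (List.mem_of_mem_head? hy))
      simp only [List.getLast?_singleton, Option.mem_def, Option.some.injEq] at hx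
      omega
    · intro x hx y hy
      have := le_of_mem_ruler (List.mem_of_mem_getLast? hx)
      simp at hy
      omega

/-- The label of the edge between the positions `c - 1` and `c` of a path on `Fin p`
with edge labels `e`; beyond the two ends, the label is `a`. -/
def gapLabel {p : ℕ} (e : Fin p → Fin p → Option ℕ) (a c : ℕ) : Option ℕ :=
  if h : 0 < c ∧ c < p then e ⟨c - 1, by omega⟩ ⟨c, h.2⟩ else some a

/-- The word of the labels of the row edges crossed by a vertical line in front of column `c`. -/
def columnWord : (k p : ℕ) → (hp : 0 < p) →
    ((GP k p hp).V → (GP k p hp).V → Option ℕ) → ℕ → List (Option ℕ)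
  | 0, _, _, f, c => [gapLabel f 0 c]
  | k + 1, p, _, f, c =>
      columnWord k (2 * p) (by omega) (fun u v => f (Sum.inl u) (Sum.inl v)) c ++
        [gapLabel (fun i j : Fin p => f (Sum.inr i) (Sum.inr j)) (k + 1) c] ++
        (columnWord k (2 * p) (by omega) (fun u v => f (Sum.inl u) (Sum.inl v))
          (2 * p - c)).reverse

lemma columnWord_length {k p : ℕ} (hp : 0 < p)
    (f : (GP k p hp).V → (GP k p hp).V → Option ℕ) (c : ℕ) :
    (columnWord k p hp f c).length = (ruler k).length := by
  induction k generalizing p c with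
  | zero => rfl
  | succ k ih =>
    simp only [columnWord, ruler, List.length_append, List.length_reverse, ih]
    rfl

open ReducedWord in
lemma columnWord_ends {k p : ℕ} (hp : 0 < p) (f : (GP k p hp).V → (GP k p hp).V → Option ℕ)
    (h : ∀ m ≤ k, wordVal (letterUpTo m) (columnWord k p hp f 0) =
      wordVal (letterUpTo m) (columnWord k p hp f p)) :
    columnWord k p hp f 0 = (ruler k).map some ∧ columnWord k p hp f p = (ruler k).map some := by
  induction k generalizing p with
  | zero => simp [columnWord, ruler, gapLabel]
  | succ k ih =>
    have h2 : 2 * p - p = p := by omega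
    obtain ⟨h0, hlast⟩ := ih (by omega : 0 < 2 * p) (fun u v => f (Sum.inl u) (Sum.inl v))
      fun m hm => by
        have := h m (by omega)
        have hone : optVal (letterUpTo m) (some (k + 1)) = 1 :=
          letterUpTo_of_lt (by omega)
        simp only [columnWord, wordVal_append, wordVal_singleton,
          wordVal_reverse (letterUpTo_mul_self m), gapLabel, h2] at this
        simpa [hone, mul_inv_eq_one] using this
    have hzero : columnWord (k + 1) p hp f 0 = (ruler (k + 1)).map some := by
      simp only [columnWord, Nat.sub_zero]
      rw [h0, hlast]
      simp [ruler, gapLabel]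
    refine ⟨hzero, eq_map_some_of_wordVal_eq (m := k + 1) (isChain_ruler _)
      (fun _ => le_of_mem_ruler) (columnWord_length hp f p) ?_⟩
    rw [← hzero, h _ le_rfl]

/-- The labels around a vertex, in the order left, up, right, down: they use at most one letter,
and they use it an even number of times. -/
def BalancedLabels (l u r d : Option ℕ) : Prop :=
  ∃ j, (l = none ∨ l = some j) ∧ (u = none ∨ u = some j) ∧ (r = none ∨ r = some j) ∧
    (d = none ∨ d = some j) ∧
    ((if l = some j then 1 else 0) + (if u = some j then 1 else 0) + (if r = some j then 1 else 0)
      + (if d = some j then 1 else 0) : ZMod 2) = 0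

lemma BalancedLabels.optVal {Γ : Type*} [Group Γ] {φ : ℕ → Γ} (hφ : ∀ j, φ j * φ j = 1)
    {l u r d : Option ℕ} (h : BalancedLabels l u r d) :
    optVal φ l * optVal φ d = optVal φ u * optVal φ r := by
  obtain ⟨j, hl, hu, hr, hd, hp⟩ := h
  rcases hl with rfl | rfl <;> rcases hu with rfl | rfl <;> rcases hr with rfl | rfl <;>
    rcases hd with rfl | rfl <;> first
      | simp [_root_.optVal, hφ]; done
      | exact absurd hp (by simp <;> decide)

lemma BalancedLabels.eq_none_iff {l u r d : Option ℕ} (h : BalancedLabels l u r d) (hl : l ≠ none)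
    (hr : r ≠ none) : u = none ↔ d = none := by
  obtain ⟨j, hl', hu, hr', hd, hp⟩ := h
  rcases hl' with rfl | rfl <;> rcases hu with rfl | rfl <;> rcases hr' with rfl | rfl <;>
    rcases hd with rfl | rfl <;> first
      | simp at hl hr ⊢; done
      | exact absurd hp (by simp; decide)

/-- Labels on the top and bottom sides of `2 * p` columns which are folded to `p` columns with
labels `τ` and `β`. -/
def unfoldLabel (p : ℕ) (τ β : ℕ → Option ℕ) (c : ℕ) : Option ℕ :=
  if c < p then τ c else β (2 * p - 1 - c)

instance GP.instFintype : (k p : ℕ) → (hp : 0 < p) → Fintype (GP k p hp).V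
  | 0, p, _ => inferInstanceAs (Fintype (Fin p))
  | k + 1, p, _ =>
    letI := GP.instFintype k (2 * p) (by omega)
    inferInstanceAs (Fintype ((GP k (2 * p) (by omega)).V ⊕ Fin p))

open Classical in
/-- Edge labels `f` of `GP k p hp`, together with labels `τ` and `β` of half-edges at its top and
bottom row, such that the edges of every label `j` form paths and cycles, except for ends at the
`j`-th terminals, and edges with distinct labels do not meet. -/
structure IsPathLabelling (k p : ℕ) (hp : 0 < p)
    (f : (GP k p hp).V → (GP k p hp).V → Option ℕ) (τ β : ℕ → Option ℕ) : Prop where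
  symm : ∀ u v, f u v = f v u
  adj : ∀ u v, f u v ≠ none → (GP k p hp).G.Adj u v
  unique : ∀ v, ∃ j, (∀ u, f v u = none ∨ f v u = some j) ∧
    (∀ c : Fin p, (GP k p hp).top c = v → τ c = none ∨ τ c = some j) ∧
    (∀ c : Fin p, (GP k p hp).bot c = v → β c = none ∨ β c = some j) ∧
    ∀ i ≤ k, (GP k p hp).s i = v ∨ (GP k p hp).t i = v → i = j
  parity : ∀ v j, ((∑ u, if f v u = some j then 1 else 0) +
    (∑ c : Fin p, if (GP k p hp).top c = v ∧ τ c = some j then 1 else 0) +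
    (∑ c : Fin p, if (GP k p hp).bot c = v ∧ β c = some j then 1 else 0) +
    if j ≤ k then (if (GP k p hp).s j = v then 1 else 0) + (if (GP k p hp).t j = v then 1 else 0)
      else 0 : ZMod 2) = 0

/-- The label of the edge from the bottom row of `GP k (2 * p) _` to the path that is added
in `GP (k + 1) p _`. -/
def downLabel {k p : ℕ} {hp : 0 < p} (f : (GP (k + 1) p hp).V → (GP (k + 1) p hp).V → Option ℕ)
    (c : ℕ) : Option ℕ :=
  if h : c < 2 * p then
    if h' : c < p then f (Sum.inr ⟨c, h'⟩) (Sum.inl ((GP k (2 * p) (by omega)).bot ⟨c, h⟩))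
    else f (Sum.inr ⟨2 * p - 1 - c, by omega⟩) (Sum.inl ((GP k (2 * p) (by omega)).bot ⟨c, h⟩))
  else none

lemma GP_top_injective {k p : ℕ} (hp : 0 < p) : Function.Injective (GP k p hp).top := by
  induction k generalizing p with
  | zero => exact Function.injective_id
  | succ k ih =>
    intro c c' h
    have := ih _ (Sum.inl_injective h)
    simpa [Fin.ext_iff] using this

lemma GP_bot_injective {k p : ℕ} (hp : 0 < p) : Function.Injective (GP k p hp).bot := by
  cases k with
  | zero => exact Function.injective_id
  | succ k =>
    intro c c' h
    have := GP_top_injective _ (Sum.inl_injective h)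
    simp only [Fin.mk.injEq] at this
    omega

lemma sum_fin_two_mul {M : Type*} [AddCommMonoid M] {p : ℕ} (F : Fin (2 * p) → M) :
    ∑ c, F c = ∑ c : Fin p, (F ⟨c, by omega⟩ + F ⟨2 * p - 1 - c, by omega⟩) := by
  let e : Fin p ⊕ Fin p → Fin (2 * p) :=
    Sum.elim (fun c => ⟨c, by omega⟩) fun c => ⟨2 * p - 1 - c, by omega⟩
  have he : Function.Bijective e := by
    rw [Fintype.bijective_iff_injective_and_card]
    refine ⟨?_, by simp [two_mul]⟩
    rintro (a | a) (b | b) h <;> simp only [e, Sum.elim_inl, Sum.elim_inr, Fin.mk.injEq] at h <;>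
      simp only [Sum.inl.injEq, Sum.inr.injEq, reduceCtorEq, Fin.ext_iff] <;> omega
  rw [← he.sum_comp, Fintype.sum_sum_type, Finset.sum_add_distrib]
  rfl

/-- The number of incident edges with label `j` at a vertex of a path, counted on the two sides. -/
lemma sum_gapLabel {p : ℕ} {e : Fin p → Fin p → Option ℕ} (hsymm : ∀ c d, e c d = e d c)
    (hadj : ∀ c d, e c d ≠ none → c.val + 1 = d.val ∨ d.val + 1 = c.val) (a j : ℕ) (c : Fin p) :
    ((∑ d, if e c d = some j then 1 else 0) +
      (if j = a then (if c.val = 0 then 1 else 0) + (if c.val = p - 1 then 1 else 0) else 0) :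
      ZMod 2) =
    (if gapLabel e a c = some j then 1 else 0) +
      (if gapLabel e a (c + 1) = some j then 1 else 0) := by
  have hterm : ∀ d : Fin p, ((if e c d = some j then 1 else 0) : ZMod 2) =
      (if d.val + 1 = c.val then (if e c d = some j then 1 else 0) else 0) +
      (if d.val = c.val + 1 then (if e c d = some j then 1 else 0) else 0) := by
    intro d
    by_cases h : e c d = none
    · simp [h]
    · rcases hadj c d h with h | h
      · simp [show d.val = c.val + 1 by omega, show ¬ c.val + 1 + 1 = c.val by omega]
      · simp [h, show ¬ d.val = c.val + 1 by omega]
  have hleft : (∑ d : Fin p, if d.val + 1 = c.val then (if e c d = some j then 1 else 0) else 0 :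
      ZMod 2) + (if j = a then (if c.val = 0 then 1 else 0) else 0) =
      if gapLabel e a c = some j then 1 else 0 := by
    by_cases hc : c.val = 0
    · simp [hc, gapLabel, eq_comm]
    · rw [Finset.sum_eq_single ⟨c.val - 1, by omega⟩]
      · have hd : (⟨c.val, c.2⟩ : Fin p) = c := rfl
        simp [hc, gapLabel, show 0 < c.val by omega, show c.val - 1 + 1 = c.val by omega,
          hsymm c ⟨c.val - 1, by omega⟩]
      · intro d _ hd
        rw [if_neg]
        intro h
        exact hd (Fin.ext (by simp; omega))
      · simp
  have hright : (∑ d : Fin p, if d.val = c.val + 1 then (if e c d = some j then 1 else 0) else 0 :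
      ZMod 2) + (if j = a then (if c.val = p - 1 then 1 else 0) else 0) =
      if gapLabel e a (c + 1) = some j then 1 else 0 := by
    by_cases hc : c.val = p - 1
    · rw [Finset.sum_eq_zero]
      · simp [hc, gapLabel, show p - 1 + 1 = p by omega, eq_comm]
      · intro d _
        rw [if_neg]
        omega
    · rw [Finset.sum_eq_single ⟨c.val + 1, by omega⟩]
      · simp [hc, gapLabel, show c.val + 1 < p by omega]
      · intro d _ hd
        rw [if_neg]
        intro h
        exact hd (Fin.ext h)
      · simp
  rw [Finset.sum_congr rfl fun d _ => hterm d, Finset.sum_add_distrib, ← hleft, ← hright]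
  split_ifs <;> ring

lemma GP_adj_inl_inl {k p : ℕ} {hp : 0 < p} {u v : (GP k (2 * p) (by omega)).V}
    (h : (GP (k + 1) p hp).G.Adj (Sum.inl u) (Sum.inl v)) : (GP k (2 * p) (by omega)).G.Adj u v := by
  obtain ⟨-, h | h⟩ := h
  · exact h
  · exact h.symm

lemma GP_adj_inr_inr {k p : ℕ} {hp : 0 < p} {c d : Fin p}
    (h : (GP (k + 1) p hp).G.Adj (Sum.inr c) (Sum.inr d)) :
    c.val + 1 = d.val ∨ d.val + 1 = c.val := h.2

lemma GP_adj_inr_inl {k p : ℕ} {hp : 0 < p} {c : Fin p} {v : (GP k (2 * p) (by omega)).V}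
    (h : (GP (k + 1) p hp).G.Adj (Sum.inr c) (Sum.inl v)) :
    v = (GP k (2 * p) (by omega)).bot ⟨c, by omega⟩ ∨
      v = (GP k (2 * p) (by omega)).bot ⟨2 * p - 1 - c, by omega⟩ := by
  obtain ⟨-, h | h⟩ := h
  · exact h
  · exact h.elim

lemma GP_bot_ne_bot {k p : ℕ} (hp : 0 < p) (c : Fin p) :
    (GP k (2 * p) (by omega)).bot ⟨c, by omega⟩ ≠
      (GP k (2 * p) (by omega)).bot ⟨2 * p - 1 - c, by omega⟩ := by
  intro h
  have := GP_bot_injective _ h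
  simp only [Fin.mk.injEq] at this
  omega

lemma forall_fin_two_mul {p : ℕ} {P : Fin (2 * p) → Prop} (h1 : ∀ c : Fin p, P ⟨c, by omega⟩)
    (h2 : ∀ c : Fin p, P ⟨2 * p - 1 - c, by omega⟩) (c : Fin (2 * p)) : P c := by
  by_cases hc : c.val < p
  · exact h1 ⟨c, hc⟩
  · have := h2 ⟨2 * p - 1 - c, by omega⟩
    convert this using 1
    ext
    simp only
    omega

lemma forall_le_two_mul {p : ℕ} {P : ℕ → Prop} (h : ∀ c ≤ p, P c ∧ P (2 * p - c)) {c : ℕ}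
    (hc : c ≤ 2 * p) : P c := by
  by_cases hcp : c ≤ p
  · exact (h c hcp).1
  · have := (h (2 * p - c) (by omega)).2
    rwa [show 2 * p - (2 * p - c) = c by omega] at this

lemma eq_of_gapLabel_eq {p : ℕ} {e e' : Fin p → Fin p → Option ℕ} (hsymm : ∀ c d, e c d = e d c)
    (hadj : ∀ c d, e c d ≠ none → c.val + 1 = d.val ∨ d.val + 1 = c.val)
    (hsymm' : ∀ c d, e' c d = e' d c)
    (hadj' : ∀ c d, e' c d ≠ none → c.val + 1 = d.val ∨ d.val + 1 = c.val) {a : ℕ}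
    (h : ∀ c ≤ p, gapLabel e a c = gapLabel e' a c) : e = e' := by
  have hsucc : ∀ c d : Fin p, c.val + 1 = d.val → e c d = e' c d := fun c d hcd => by
    have hd : 0 < d.val ∧ d.val < p := by omega
    have hc : (⟨d.val - 1, by omega⟩ : Fin p) = c := Fin.ext (by simp only; omega)
    simpa [gapLabel, hd, hc] using h d (by omega)
  ext1 c
  ext1 d
  by_cases h1 : c.val + 1 = d.val
  · exact hsucc c d h1
  by_cases h2 : d.val + 1 = c.val
  · rw [hsymm, hsymm']
    exact hsucc d c h2
  have h3 : e c d = none := by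
    by_contra h'
    exact (hadj c d h').elim h1 h2
  have h4 : e' c d = none := by
    by_contra h'
    exact (hadj' c d h').elim h1 h2
  rw [h3, h4]

section IsPathLabelling

variable {k p : ℕ} {hp : 0 < p}

lemma downLabel_left (f : (GP (k + 1) p hp).V → (GP (k + 1) p hp).V → Option ℕ) (c : Fin p) :
    downLabel f c = f (Sum.inr c) (Sum.inl ((GP k (2 * p) (by omega)).bot ⟨c, by omega⟩)) := by
  have : c.val < 2 * p := by omega
  simp [downLabel, this]

lemma downLabel_right (f : (GP (k + 1) p hp).V → (GP (k + 1) p hp).V → Option ℕ) (c : Fin p) :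
    downLabel f (2 * p - 1 - c) =
      f (Sum.inr c) (Sum.inl ((GP k (2 * p) (by omega)).bot ⟨2 * p - 1 - c, by omega⟩)) := by
  have h1 : 2 * p - 1 - c.val < 2 * p := by omega
  have h2 : ¬ 2 * p - 1 - c.val < p := by omega
  have h3 : 2 * p - 1 - (2 * p - 1 - c.val) = c.val := by omega
  simp [downLabel, h1, h2, h3]

lemma unfoldLabel_left (τ β : ℕ → Option ℕ) (c : Fin p) : unfoldLabel p τ β c = τ c := by
  simp [unfoldLabel]

lemma unfoldLabel_right (τ β : ℕ → Option ℕ) (c : Fin p) :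
    unfoldLabel p τ β (2 * p - 1 - c) = β c := by
  have h2 : ¬ 2 * p - 1 - c.val < p := by omega
  have h3 : 2 * p - 1 - (2 * p - 1 - c.val) = c.val := by omega
  simp [unfoldLabel, h2, h3]

lemma IsPathLabelling.balanced_zero {f : (GP 0 p hp).V → (GP 0 p hp).V → Option ℕ}
    {τ β : ℕ → Option ℕ} (h : IsPathLabelling 0 p hp f τ β) (c : Fin p) :
    BalancedLabels (gapLabel f 0 c) (τ c) (gapLabel f 0 (c + 1)) (β c) := by
  obtain ⟨j, hf, hτ, hβ, hst⟩ := h.unique c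
  have hsum := sum_gapLabel h.symm (fun c d hcd => (h.adj c d hcd).2) 0 j c
  refine ⟨j, ?_, hτ c rfl, ?_, hβ c rfl, ?_⟩
  · unfold gapLabel
    split_ifs with hc
    · rw [h.symm ⟨c - 1, by omega⟩ c]
      exact hf _
    · have : c.val = 0 := by omega
      exact Or.inr (congrArg some (hst 0 le_rfl (Or.inl (Fin.ext this.symm))))
  · unfold gapLabel
    split_ifs with hc
    · exact hf ⟨c + 1, hc.2⟩
    · have : c.val = p - 1 := by omega
      exact Or.inr (congrArg some (hst 0 le_rfl (Or.inr (Fin.ext this.symm))))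
  · classical
    have hpar : ((∑ d : Fin p, if f c d = some j then 1 else 0) +
        (∑ d : Fin p, if d = c ∧ τ d = some j then 1 else 0) +
        (∑ d : Fin p, if d = c ∧ β d = some j then 1 else 0) +
        (if j = 0 then (if c.val = 0 then 1 else 0) + (if c.val = p - 1 then 1 else 0) else 0) :
        ZMod 2) = 0 := by
      refine Eq.trans ?_ (h.parity c j)
      have hs : c.val = 0 ↔ (GP 0 p hp).s j = c :=
        ⟨fun h => Fin.ext h.symm, fun h => (congrArg Fin.val h).symm⟩
      have ht : c.val = p - 1 ↔ (GP 0 p hp).t j = c :=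
        ⟨fun h => Fin.ext h.symm, fun h => (congrArg Fin.val h).symm⟩
      simp only [hs, ht, ← Nat.le_zero]
      refine congrArg₂ (· + ·) (congrArg₂ (· + ·) (congrArg₂ (· + ·) ?_ ?_) ?_) ?_
      · exact Finset.sum_congr rfl fun _ _ => if_congr Iff.rfl rfl rfl
      · exact Finset.sum_congr rfl fun _ _ => if_congr Iff.rfl rfl rfl
      · exact Finset.sum_congr rfl fun _ _ => if_congr Iff.rfl rfl rfl
      · congr!
    have hrow (σ : ℕ → Option ℕ) : (∑ d : Fin p, if d = c ∧ σ d = some j then 1 else 0 : ZMod 2) =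
        if σ c = some j then 1 else 0 := by
      simp [ite_and]
    rw [hrow, hrow] at hpar
    linear_combination hpar - hsum

lemma IsPathLabelling.balanced_succ {f : (GP (k + 1) p hp).V → (GP (k + 1) p hp).V → Option ℕ}
    {τ β : ℕ → Option ℕ} (h : IsPathLabelling (k + 1) p hp f τ β) (c : Fin p) :
    BalancedLabels (gapLabel (fun i j : Fin p => f (Sum.inr i) (Sum.inr j)) (k + 1) c)
      (downLabel f c) (gapLabel (fun i j : Fin p => f (Sum.inr i) (Sum.inr j)) (k + 1) (c + 1))
      (downLabel f (2 * p - 1 - c)) := by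
  obtain ⟨j, hf, -, -, hst⟩ := h.unique (Sum.inr c)
  have hsum := sum_gapLabel (e := fun i j : Fin p => f (Sum.inr i) (Sum.inr j))
    (fun _ _ => h.symm _ _) (fun c d hcd => GP_adj_inr_inr (h.adj _ _ hcd)) (k + 1) j c
  have hs (i : ℕ) (hi : i ≤ k + 1) :
      (GP (k + 1) p hp).s i = Sum.inr c ↔ i = k + 1 ∧ c.val = 0 := by
    by_cases hik : i = k + 1
    · subst hik
      simp [GP, stepRG, Fin.ext_iff, eq_comm]
    · simp [GP, stepRG, show i < k + 1 by omega, hik]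
  have ht (i : ℕ) (hi : i ≤ k + 1) :
      (GP (k + 1) p hp).t i = Sum.inr c ↔ i = k + 1 ∧ c.val = p - 1 := by
    by_cases hik : i = k + 1
    · subst hik
      simp [GP, stepRG, Fin.ext_iff, eq_comm]
    · simp [GP, stepRG, show i < k + 1 by omega, hik]
  have hf' (v : (GP (k + 1) p hp).V) : f v (Sum.inr c) = none ∨ f v (Sum.inr c) = some j :=
    (hf v).imp (h.symm _ _).trans (h.symm _ _).trans
  rw [downLabel_left, downLabel_right]
  refine ⟨j, ?_, hf _, ?_, hf _, ?_⟩
  · unfold gapLabel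
    split_ifs with hc
    · exact hf' _
    · exact Or.inr (congrArg some (hst _ le_rfl (Or.inl ((hs _ le_rfl).2 ⟨rfl, by omega⟩))))
  · unfold gapLabel
    split_ifs with hc
    · exact hf _
    · exact Or.inr (congrArg some (hst _ le_rfl (Or.inr ((ht _ le_rfl).2 ⟨rfl, by omega⟩))))
  · classical
    have hpar : ((∑ v : (GP k (2 * p) (by omega)).V,
          if f (Sum.inr c) (Sum.inl v) = some j then 1 else 0) +
        (∑ d : Fin p, if f (Sum.inr c) (Sum.inr d) = some j then 1 else 0) +
        (if j = k + 1 then (if c.val = 0 then 1 else 0) + (if c.val = p - 1 then 1 else 0) else 0) :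
        ZMod 2) = 0 := by
      rw [← Fintype.sum_sum_type (fun v : (GP k (2 * p) (by omega)).V ⊕ Fin p =>
        (if f (Sum.inr c) v = some j then 1 else 0 : ZMod 2))]
      have hpar := h.parity (Sum.inr c) j
      have hrow (σ : ℕ → Option ℕ) (r : Fin p → (GP (k + 1) p hp).V)
          (hr : ∀ d, r d ≠ Sum.inr c) :
          (∑ d : Fin p, if r d = Sum.inr c ∧ σ d = some j then 1 else 0 : ZMod 2) = 0 :=
        Finset.sum_eq_zero fun d _ => if_neg fun hd => hr d hd.1
      rw [hrow τ (GP (k + 1) p hp).top (fun _ => Sum.inl_ne_inr),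
        hrow β (GP (k + 1) p hp).bot (fun _ => Sum.inl_ne_inr), add_zero, add_zero] at hpar
      refine Eq.trans ?_ hpar
      refine congrArg₂ (· + ·) (Finset.sum_congr rfl fun _ _ => if_congr Iff.rfl rfl rfl) ?_
      by_cases hj : j ≤ k + 1
      · simp only [hj, if_true, hs j hj, ht j hj]
        by_cases hj' : j = k + 1 <;> simp [hj']
      · simp [hj, show j ≠ k + 1 by omega]
    have hcol : (∑ v : (GP k (2 * p) (by omega)).V,
        if f (Sum.inr c) (Sum.inl v) = some j then 1 else 0 : ZMod 2) =
        (if f (Sum.inr c) (Sum.inl ((GP k (2 * p) (by omega)).bot ⟨c, by omega⟩)) = some j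
          then 1 else 0) +
        if f (Sum.inr c) (Sum.inl ((GP k (2 * p) (by omega)).bot ⟨2 * p - 1 - c, by omega⟩)) =
          some j then 1 else 0 := by
      refine Fintype.sum_eq_add _ _ (GP_bot_ne_bot hp c) fun v hv => if_neg fun hj => ?_
      exact (GP_adj_inr_inl (h.adj _ _ (by simp [hj]))).elim hv.1 hv.2
    rw [hcol] at hpar
    linear_combination hpar - hsum

lemma IsPathLabelling.restrict {f : (GP (k + 1) p hp).V → (GP (k + 1) p hp).V → Option ℕ}
    {τ β : ℕ → Option ℕ} (h : IsPathLabelling (k + 1) p hp f τ β) :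
    IsPathLabelling k (2 * p) (by omega) (fun u v => f (Sum.inl u) (Sum.inl v))
      (unfoldLabel p τ β) (downLabel f) where
  symm _ _ := h.symm _ _
  adj u v huv := GP_adj_inl_inl (h.adj _ _ huv)
  unique v := by
    obtain ⟨j, hf, hτ, hβ, hst⟩ := h.unique (Sum.inl v)
    have hf' (u : (GP (k + 1) p hp).V) : f u (Sum.inl v) = none ∨ f u (Sum.inl v) = some j :=
      (hf u).imp (h.symm _ _).trans (h.symm _ _).trans
    refine ⟨j, fun u => hf _, forall_fin_two_mul ?_ ?_, forall_fin_two_mul ?_ ?_, ?_⟩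
    · intro c hc
      rw [unfoldLabel_left]
      exact hτ c (congrArg Sum.inl hc)
    · intro c hc
      rw [unfoldLabel_right]
      exact hβ c (congrArg Sum.inl hc)
    · rintro c rfl
      rw [downLabel_left]
      exact hf' _
    · rintro c rfl
      rw [downLabel_right]
      exact hf' _
    · intro i hi hiv
      refine hst i (by omega) (hiv.imp ?_ ?_) <;> rintro rfl <;> exact if_pos (by omega)
  parity v j := by
    classical
    have hpar : ((∑ u : (GP k (2 * p) (by omega)).V,
          if f (Sum.inl v) (Sum.inl u) = some j then 1 else 0) +
        (∑ c : Fin p, if f (Sum.inl v) (Sum.inr c) = some j then 1 else 0) +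
        (∑ c : Fin p, if (GP k (2 * p) (by omega)).top ⟨c, by omega⟩ = v ∧ τ c = some j
          then 1 else 0) +
        (∑ c : Fin p, if (GP k (2 * p) (by omega)).top ⟨2 * p - 1 - c, by omega⟩ = v ∧
          β c = some j then 1 else 0) +
        (if j ≤ k then (if (GP k (2 * p) (by omega)).s j = v then 1 else 0) +
          (if (GP k (2 * p) (by omega)).t j = v then 1 else 0) else 0) : ZMod 2) = 0 := by
      rw [← Fintype.sum_sum_type (fun u : (GP k (2 * p) (by omega)).V ⊕ Fin p =>
        (if f (Sum.inl v) u = some j then 1 else 0 : ZMod 2))]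
      refine Eq.trans ?_ (h.parity (Sum.inl v) j)
      refine congrArg₂ (· + ·) (congrArg₂ (· + ·) (congrArg₂ (· + ·) ?_ ?_) ?_) ?_
      · exact Finset.sum_congr rfl fun _ _ => if_congr Iff.rfl rfl rfl
      · exact Finset.sum_congr rfl fun _ _ =>
          if_congr (and_congr_left' Sum.inl_injective.eq_iff.symm) rfl rfl
      · exact Finset.sum_congr rfl fun _ _ =>
          if_congr (and_congr_left' Sum.inl_injective.eq_iff.symm) rfl rfl
      · rcases lt_trichotomy j (k + 1) with hj | rfl | hj
        · simp [GP, stepRG, hj, Nat.le_of_lt_succ hj, hj.le]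
        · simp [GP, stepRG]
        · simp [show ¬ j ≤ k by omega, show ¬ j ≤ k + 1 by omega]
    rw [sum_fin_two_mul, sum_fin_two_mul]
    simp only [unfoldLabel_left, unfoldLabel_right, downLabel_left, downLabel_right]
    have hcol : ∀ c : Fin p, (if f (Sum.inl v) (Sum.inr c) = some j then 1 else 0 : ZMod 2) =
        (if (GP k (2 * p) (by omega)).bot ⟨c, by omega⟩ = v ∧ f (Sum.inr c)
          (Sum.inl ((GP k (2 * p) (by omega)).bot ⟨c, by omega⟩)) = some j then 1 else 0) +
        if (GP k (2 * p) (by omega)).bot ⟨2 * p - 1 - c, by omega⟩ = v ∧ f (Sum.inr c)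
          (Sum.inl ((GP k (2 * p) (by omega)).bot ⟨2 * p - 1 - c, by omega⟩)) = some j
          then 1 else 0 := by
      intro c
      have hne := GP_bot_ne_bot (k := k) hp c
      rw [h.symm (Sum.inl v) (Sum.inr c)]
      by_cases h1 : (GP k (2 * p) (by omega)).bot ⟨c, by omega⟩ = v
      · subst h1
        simp [hne.symm]
      · by_cases h2 : (GP k (2 * p) (by omega)).bot ⟨2 * p - 1 - c, by omega⟩ = v
        · subst h2
          simp [hne]
        · rw [if_neg, if_neg fun hv => h1 hv.1, if_neg fun hv => h2 hv.1, add_zero]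
          intro hj
          exact (GP_adj_inr_inl (h.adj _ _ (by simp [hj]))).elim (fun hv => h1 hv.symm)
            fun hv => h2 hv.symm
    rw [Finset.sum_congr rfl fun c _ => hcol c] at hpar
    simp only [Finset.sum_add_distrib] at hpar ⊢
    linear_combination hpar

lemma IsPathLabelling.wordVal_columnWord {Γ : Type*} [Group Γ] {φ : ℕ → Γ}
    (hφ : ∀ j, φ j * φ j = 1) {f : (GP k p hp).V → (GP k p hp).V → Option ℕ}
    {τ β : ℕ → Option ℕ} (h : IsPathLabelling k p hp f τ β) (c : Fin p) :
    wordVal φ (columnWord k p hp f c) * optVal φ (β c) =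
      optVal φ (τ c) * wordVal φ (columnWord k p hp f (c + 1)) := by
  induction k generalizing p τ β with
  | zero =>
    simp only [columnWord, wordVal_singleton]
    exact (h.balanced_zero c).optVal hφ
  | succ k ih =>
    have h1 := ih h.restrict ⟨c, by omega⟩
    have h2 := ih h.restrict ⟨2 * p - 1 - c, by omega⟩
    have h3 := (h.balanced_succ c).optVal hφ
    simp only [unfoldLabel_left, unfoldLabel_right] at h1 h2
    rw [show 2 * p - 1 - c.val + 1 = 2 * p - c by omega] at h2
    simp only [columnWord, wordVal_append, wordVal_singleton, wordVal_reverse hφ]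
    rw [show 2 * p - (c.val + 1) = 2 * p - 1 - c by omega]
    generalize wordVal φ (columnWord k (2 * p) _ _ (2 * p - c.val)) = A at *
    generalize wordVal φ (columnWord k (2 * p) _ _ (2 * p - 1 - c.val)) = B at *
    generalize wordVal φ (columnWord k (2 * p) _ _ c.val) = C at *
    generalize wordVal φ (columnWord k (2 * p) _ _ (c.val + 1)) = D at *
    have h4 : A⁻¹ * optVal φ (β c) = optVal φ (downLabel f (2 * p - 1 - c)) * B⁻¹ := by
      have := congrArg (·⁻¹) h2
      simpa only [mul_inv_rev, optVal_inv hφ] using this.symm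
    rw [mul_assoc, h4, ← mul_assoc, mul_assoc C, h3, ← mul_assoc, h1]
    simp only [mul_assoc]

lemma IsPathLabelling.wordVal_columnWord_eq {Γ : Type*} [Group Γ] {φ : ℕ → Γ}
    (hφ : ∀ j, φ j * φ j = 1) {f : (GP k p hp).V → (GP k p hp).V → Option ℕ}
    (h : IsPathLabelling k p hp f (fun _ => none) fun _ => none) {c : ℕ} (hc : c ≤ p) :
    wordVal φ (columnWord k p hp f c) = wordVal φ (columnWord k p hp f 0) := by
  induction c with
  | zero => rfl
  | succ c ih =>
    rw [← ih (by omega)]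
    simpa [optVal] using (h.wordVal_columnWord hφ ⟨c, hc⟩).symm

open ReducedWord in
lemma IsPathLabelling.columnWord_eq {f : (GP k p hp).V → (GP k p hp).V → Option ℕ}
    (h : IsPathLabelling k p hp f (fun _ => none) fun _ => none) {c : ℕ} (hc : c ≤ p) :
    columnWord k p hp f c = (ruler k).map some := by
  have h0 := (columnWord_ends hp f fun m _ =>
    (h.wordVal_columnWord_eq (letterUpTo_mul_self m) le_rfl).symm).1
  refine eq_map_some_of_wordVal_eq (m := k) (isChain_ruler _) (fun _ => le_of_mem_ruler)
    (columnWord_length hp f c) ?_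
  rw [h.wordVal_columnWord_eq (letterUpTo_mul_self k) hc, h0]

lemma columnWord_succ_inj {f f' : (GP (k + 1) p hp).V → (GP (k + 1) p hp).V → Option ℕ} {c : ℕ}
    (h : columnWord (k + 1) p hp f c = columnWord (k + 1) p hp f' c) :
    columnWord k (2 * p) (by omega) (fun u v => f (Sum.inl u) (Sum.inl v)) c =
        columnWord k (2 * p) (by omega) (fun u v => f' (Sum.inl u) (Sum.inl v)) c ∧
      gapLabel (fun i j : Fin p => f (Sum.inr i) (Sum.inr j)) (k + 1) c =
        gapLabel (fun i j : Fin p => f' (Sum.inr i) (Sum.inr j)) (k + 1) c ∧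
      columnWord k (2 * p) (by omega) (fun u v => f (Sum.inl u) (Sum.inl v)) (2 * p - c) =
        columnWord k (2 * p) (by omega) (fun u v => f' (Sum.inl u) (Sum.inl v)) (2 * p - c) := by
  simp only [columnWord] at h
  obtain ⟨h, h3⟩ := List.append_inj' h (by simp [columnWord_length])
  obtain ⟨h1, h2⟩ := List.append_inj' h rfl
  exact ⟨h1, List.singleton_inj.1 h2, List.reverse_injective h3⟩

lemma IsPathLabelling.eq_none_iff {f : (GP k p hp).V → (GP k p hp).V → Option ℕ}
    {τ β : ℕ → Option ℕ} (h : IsPathLabelling k p hp f τ β)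
    (hf : ∀ c ≤ p, none ∉ columnWord k p hp f c) (c : Fin p) : τ c = none ↔ β c = none := by
  induction k generalizing p τ β with
  | zero =>
    refine (h.balanced_zero c).eq_none_iff (fun h' => ?_) fun h' => ?_
    · exact hf c (by omega) (by simp [columnWord, h'])
    · exact hf (c + 1) (by omega) (by simp [columnWord, h'])
  | succ k ih =>
    have hf' : ∀ c ≤ 2 * p, none ∉ columnWord k (2 * p) (by omega)
        (fun u v => f (Sum.inl u) (Sum.inl v)) c := fun c hc =>
      forall_le_two_mul (P := fun c => none ∉ columnWord k (2 * p) (by omega)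
        (fun u v => f (Sum.inl u) (Sum.inl v)) c) (fun c hc => by
          have := hf c hc
          simp only [columnWord, List.mem_append, List.mem_reverse, not_or] at this
          exact ⟨this.1.1, this.2⟩) hc
    have h1 := ih h.restrict hf' ⟨c, by omega⟩
    have h2 := ih h.restrict hf' ⟨2 * p - 1 - c, by omega⟩
    simp only [unfoldLabel_left, unfoldLabel_right] at h1 h2
    rw [h1, h2]
    refine (h.balanced_succ c).eq_none_iff (fun h' => ?_) fun h' => ?_
    · exact hf c (by omega) (by simp [columnWord, h'])
    · exact hf (c + 1) (by omega) (by simp [columnWord, h'])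

/-- Edges between the new path and the old graph have no label if no edge leaving the old bottom
row has one. -/
lemma IsPathLabelling.inr_inl_eq_none
    {f : (GP (k + 1) p hp).V → (GP (k + 1) p hp).V → Option ℕ} {τ β : ℕ → Option ℕ}
    (h : IsPathLabelling (k + 1) p hp f τ β) (hd : ∀ c : Fin (2 * p), downLabel f c = none)
    (c : Fin p) (v : (GP k (2 * p) (by omega)).V) : f (Sum.inr c) (Sum.inl v) = none := by
  by_contra h'
  rcases GP_adj_inr_inl (h.adj _ _ h') with rfl | rfl
  · exact h' ((downLabel_left f c).symm.trans (hd ⟨c, by omega⟩))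
  · exact h' ((downLabel_right f c).symm.trans (hd ⟨2 * p - 1 - c, by omega⟩))

/-- A path labelling without labels above and below the graph is determined by its column words,
if all row edges have labels. -/
lemma IsPathLabelling.eq_of_columnWord_eq {f f' : (GP k p hp).V → (GP k p hp).V → Option ℕ}
    {τ β τ' β' : ℕ → Option ℕ} (h : IsPathLabelling k p hp f τ β)
    (h' : IsPathLabelling k p hp f' τ' β') (hf : ∀ c ≤ p, none ∉ columnWord k p hp f c)
    (heq : ∀ c ≤ p, columnWord k p hp f c = columnWord k p hp f' c)
    (hτ : ∀ c : Fin p, τ c = none) (hβ : ∀ c : Fin p, β c = none)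
    (hτ' : ∀ c : Fin p, τ' c = none) (hβ' : ∀ c : Fin p, β' c = none) : f = f' := by
  induction k generalizing p τ β τ' β' with
  | zero =>
    refine eq_of_gapLabel_eq (a := 0) h.symm (fun c d hcd => (h.adj c d hcd).2) h'.symm
      (fun c d hcd => (h'.adj c d hcd).2) fun c hc => ?_
    exact List.singleton_inj.1 (heq c hc)
  | succ k ih =>
    have hfr : ∀ c ≤ 2 * p, none ∉ columnWord k (2 * p) (by omega)
        (fun u v => f (Sum.inl u) (Sum.inl v)) c := fun c hc =>
      forall_le_two_mul (P := fun c => none ∉ columnWord k (2 * p) (by omega)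
        (fun u v => f (Sum.inl u) (Sum.inl v)) c) (fun c hc => by
          have := hf c hc
          simp only [columnWord, List.mem_append, List.mem_reverse, not_or] at this
          exact ⟨this.1.1, this.2⟩) hc
    have heqr : ∀ c ≤ 2 * p,
        columnWord k (2 * p) (by omega) (fun u v => f (Sum.inl u) (Sum.inl v)) c =
          columnWord k (2 * p) (by omega) (fun u v => f' (Sum.inl u) (Sum.inl v)) c := fun c hc =>
      forall_le_two_mul (P := fun c =>
        columnWord k (2 * p) (by omega) (fun u v => f (Sum.inl u) (Sum.inl v)) c =
          columnWord k (2 * p) (by omega) (fun u v => f' (Sum.inl u) (Sum.inl v)) c)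
        (fun c hc => ⟨(columnWord_succ_inj (heq c hc)).1, (columnWord_succ_inj (heq c hc)).2.2⟩) hc
    have hτr : ∀ c : Fin (2 * p), unfoldLabel p τ β c = none := forall_fin_two_mul
      (fun c => (unfoldLabel_left τ β c).trans (hτ c))
      fun c => (unfoldLabel_right τ β c).trans (hβ c)
    have hτr' : ∀ c : Fin (2 * p), unfoldLabel p τ' β' c = none := forall_fin_two_mul
      (fun c => (unfoldLabel_left τ' β' c).trans (hτ' c))
      fun c => (unfoldLabel_right τ' β' c).trans (hβ' c)
    have hβr : ∀ c : Fin (2 * p), downLabel f c = none := fun c =>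
      (h.restrict.eq_none_iff hfr c).1 (hτr c)
    have hβr' : ∀ c : Fin (2 * p), downLabel f' c = none := fun c =>
      (h'.restrict.eq_none_iff (fun c hc => heqr c hc ▸ hfr c hc) c).1 (hτr' c)
    have hinl := ih h.restrict h'.restrict hfr heqr hτr hβr hτr' hβr'
    have hinr := eq_of_gapLabel_eq (e := fun i j : Fin p => f (Sum.inr i) (Sum.inr j))
      (e' := fun i j : Fin p => f' (Sum.inr i) (Sum.inr j)) (a := k + 1)
      (fun _ _ => h.symm _ _) (fun c d hcd => GP_adj_inr_inr (h.adj _ _ hcd))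
      (fun _ _ => h'.symm _ _) (fun c d hcd => GP_adj_inr_inr (h'.adj _ _ hcd))
      fun c hc => (columnWord_succ_inj (heq c hc)).2.1
    ext1 u
    ext1 v
    match u, v with
    | Sum.inl u, Sum.inl v => exact congrFun (congrFun hinl u) v
    | Sum.inr c, Sum.inr d => exact congrFun (congrFun hinr c) d
    | Sum.inr c, Sum.inl v =>
      exact (h.inr_inl_eq_none hβr c v).trans (h'.inr_inl_eq_none hβr' c v).symm
    | Sum.inl v, Sum.inr c =>
      rw [h.symm (Sum.inl v) (Sum.inr c), h'.symm (Sum.inl v) (Sum.inr c)]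
      exact (h.inr_inl_eq_none hβr c v).trans (h'.inr_inl_eq_none hβr' c v).symm

end IsPathLabelling

open Classical in
/-- Every vertex has an even number of edges in a trail, not counting the two ends. -/
lemma SimpleGraph.Walk.IsTrail.sum_mem_edges {V : Type*} [Fintype V] {G : SimpleGraph V} {a b : V}
    {w : G.Walk a b} (hw : w.IsTrail) (v : V) :
    ((∑ u, if s(v, u) ∈ w.edges then 1 else 0) + (if a = v then 1 else 0) +
      (if b = v then 1 else 0) : ZMod 2) = 0 := by
  induction w with
  | nil =>
    simp only [Walk.edges_nil, List.not_mem_nil, if_false, Finset.sum_const_zero, zero_add]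
    exact CharTwo.add_self_eq_zero _
  | @cons a c b hadj w ih =>
    rw [Walk.isTrail_cons] at hw
    have hne : a ≠ c := hadj.ne
    have hterm : ∀ u, (if s(v, u) ∈ (Walk.cons hadj w).edges then 1 else 0 : ZMod 2) =
        (if s(v, u) = s(a, c) then 1 else 0) + if s(v, u) ∈ w.edges then 1 else 0 := by
      intro u
      by_cases h : s(v, u) = s(a, c)
      · simp [h, hw.2]
      · simp [h]
    have hfirst : (∑ u, if s(v, u) = s(a, c) then 1 else 0 : ZMod 2) =
        (if a = v then 1 else 0) + if c = v then 1 else 0 := by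
      by_cases hav : a = v
      · subst hav
        simp [hne, hne.symm]
      · by_cases hcv : c = v
        · subst hcv
          simp [hne, hne.symm]
        · simp [Ne.symm hav, Ne.symm hcv, hav, hcv]
    rw [Finset.sum_congr rfl fun u _ => hterm u, Finset.sum_add_distrib, hfirst]
    have h2 : (2 : ZMod 2) = 0 := rfl
    linear_combination ih hw.1 + (if a = v then 1 else 0 : ZMod 2) * h2

lemma SimpleGraph.Walk.toSubgraph_eq_of_edges {V : Type*} {G : SimpleGraph V} {a b : V}
    {w w' : G.Walk a b} (h : ∀ u v, s(u, v) ∈ w.edges ↔ s(u, v) ∈ w'.edges) :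
    w.toSubgraph = w'.toSubgraph := by
  have hedges : ∀ e, e ∈ w.edges ↔ e ∈ w'.edges := fun e => Sym2.ind h e
  ext u v
  · simp only [Walk.mem_verts_toSubgraph, Walk.mem_support_iff_exists_mem_edges, hedges]
  · rw [Walk.adj_toSubgraph_iff_mem_edges, Walk.adj_toSubgraph_iff_mem_edges]
    exact h u v

open Classical in
/-- The labelling of every edge by the index of the path that contains it. -/
noncomputable def pathLabel {V : Type*} {G : SimpleGraph V} {n : ℕ} {s t : Fin n → V}
    (P : (i : Fin n) → G.Walk (s i) (t i)) (u v : V) : Option ℕ :=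
  if h : ∃ i, s(u, v) ∈ (P i).edges then some h.choose.val else none

lemma pathLabel_eq_some_iff {V : Type*} {G : SimpleGraph V} {n : ℕ} {s t : Fin n → V}
    {P : (i : Fin n) → G.Walk (s i) (t i)} (hP : IsDPPSolution G P) {u v : V} {j : ℕ} :
    pathLabel P u v = some j ↔ ∃ h : j < n, s(u, v) ∈ (P ⟨j, h⟩).edges := by
  constructor
  · intro h
    unfold pathLabel at h
    split_ifs at h with hi
    cases h
    exact ⟨hi.choose.2, hi.choose_spec⟩
  · rintro ⟨h, hj⟩
    have hi : ∃ i, s(u, v) ∈ (P i).edges := ⟨_, hj⟩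
    rw [pathLabel, dif_pos hi]
    by_contra hne
    refine hP.2 hi.choose ⟨j, h⟩ (fun h' => hne (by rw [h'])) u ?_ ?_
    · exact Walk.fst_mem_support_of_mem_edges _ hi.choose_spec
    · exact Walk.fst_mem_support_of_mem_edges _ hj

lemma IsDPPSolution.isPathLabelling {k p : ℕ} {hp : 0 < p}
    {P : (i : Fin (k + 1)) → (GP k p hp).G.Walk ((GP k p hp).s i) ((GP k p hp).t i)}
    (hP : IsDPPSolution (GP k p hp).G P) :
    IsPathLabelling k p hp (pathLabel P) (fun _ => none) fun _ => none where
  symm u v := Option.ext fun j => by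
    rw [pathLabel_eq_some_iff hP, pathLabel_eq_some_iff hP, Sym2.eq_swap (a := u)]
  adj u v h := by
    obtain ⟨j, hj⟩ := Option.ne_none_iff_exists'.1 h
    obtain ⟨_, hj⟩ := (pathLabel_eq_some_iff hP).1 hj
    exact Walk.adj_of_mem_edges _ hj
  unique v := by
    have key : ∃ j : ℕ, ∀ i, v ∈ (P i).support → i.val = j := by
      by_cases h : ∃ i, v ∈ (P i).support
      · obtain ⟨i, hi⟩ := h
        refine ⟨i, fun i' hi' => ?_⟩
        by_contra hne
        exact hP.2 i' i (fun h => hne (congrArg _ h)) v hi' hi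
      · exact ⟨0, fun i hi => (h ⟨i, hi⟩).elim⟩
    obtain ⟨j, hj⟩ := key
    refine ⟨j, fun u => ?_, fun _ _ => Or.inl rfl, fun _ _ => Or.inl rfl, fun i hi hv => ?_⟩
    · by_cases h : pathLabel P v u = none
      · exact Or.inl h
      · obtain ⟨i, hi⟩ := Option.ne_none_iff_exists'.1 h
        obtain ⟨hik, hi'⟩ := (pathLabel_eq_some_iff hP).1 hi
        rw [hi, ← hj _ (Walk.fst_mem_support_of_mem_edges _ hi')]
        exact Or.inr rfl
    · refine hj ⟨i, by omega⟩ ?_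
      rcases hv with rfl | rfl
      · exact Walk.start_mem_support _
      · exact Walk.end_mem_support _
  parity v j := by
    classical
    simp only [reduceCtorEq, and_false, if_false, Finset.sum_const_zero, add_zero,
      pathLabel_eq_some_iff hP]
    by_cases hj : j ≤ k
    · have h := (hP.1 ⟨j, by omega⟩).isTrail.sum_mem_edges v
      simpa [hj, Nat.lt_succ_of_le hj, add_assoc] using h
    · simp [hj, show ¬ j < k + 1 by omega]

lemma GP_solution_unique {k p : ℕ} (hp : 0 < p)
    {P P' : (i : Fin (k + 1)) → (GP k p hp).G.Walk ((GP k p hp).s i) ((GP k p hp).t i)}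
    (hP : IsDPPSolution (GP k p hp).G P) (hP' : IsDPPSolution (GP k p hp).G P')
    (i : Fin (k + 1)) : (P i).toSubgraph = (P' i).toSubgraph := by
  have h := hP.isPathLabelling
  have h' := hP'.isPathLabelling
  have heq : pathLabel P = pathLabel P' := h.eq_of_columnWord_eq h'
    (fun c hc => by simp [h.columnWord_eq hc])
    (fun c hc => (h.columnWord_eq hc).trans (h'.columnWord_eq hc).symm)
    (fun _ => rfl) (fun _ => rfl) (fun _ => rfl) (fun _ => rfl)
  refine Walk.toSubgraph_eq_of_edges fun u v => ?_
  have h1 := pathLabel_eq_some_iff hP (u := u) (v := v) (j := i)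
  have h2 := pathLabel_eq_some_iff hP' (u := u) (v := v) (j := i)
  rw [heq, h2] at h1
  exact ⟨fun h => (h1.2 ⟨i.2, h⟩).choose_spec, fun h => (h1.1 ⟨i.2, h⟩).choose_spec⟩

/-- For every `k ≥ 1` the Disjoint Paths Problem instance
`G_k, (s_1,t_1), …, (s_k,t_k)` has exactly one solution: any two solutions agree,
path by path, as subgraphs. -/
theorem Gk_solution_unique (k : ℕ) (hk : 1 ≤ k) :
    let R := GP (k - 1) (2 ^ k - 1) (two_pow_sub_one_pos hk)
    ∀ (P P' : (i : Fin k) → R.G.Walk (R.s i) (R.t i)),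
      IsDPPSolution R.G P → IsDPPSolution R.G P' →
      ∀ i : Fin k, (P i).toSubgraph = (P' i).toSubgraph := by
  obtain ⟨k, rfl⟩ : ∃ m, k = m + 1 := ⟨k - 1, by omega⟩
  exact fun P P' hP hP' => GP_solution_unique _ hP hP'
end

section
/- For every k ≥ 1, the instance G_k,(s_1,t_1),…,(s_k,t_k) has no irrelevant vertex; concretely, for every vertex v of G_k that is not one of the terminals s_1,…,s_k,t_1,…,t_k, the Disjoint Paths Problem instance on the induced subgraph G_k − v (with the same terminals) has no solution, while the instance on G_k itself does have a solution. -/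
open SimpleGraph

/-- `r` lies strictly between `a` and `b`. -/
def StrictBtw (a b r : ℕ) : Prop := (a < r ∧ r < b) ∨ (b < r ∧ r < a)

/-- Rows `1, …, 2 ^ k - 1` and columns `1, …, p`. -/
def InGrid (k p : ℕ) (x : ℕ × ℕ) : Prop := 1 ≤ x.1 ∧ x.1 < 2 ^ k ∧ 1 ≤ x.2 ∧ x.2 ≤ p

/-- Vertices of the first column joined by an arc on the left of the grid. -/
def LeftArc (x y : ℕ × ℕ) : Prop :=
  x.2 = 1 ∧ y.2 = 1 ∧ ∃ n, 2 ^ n < x.1 ∧ x.1 < 2 ^ (n + 1) ∧ 2 ^ n < y.1 ∧ y.1 < 2 ^ (n + 1) ∧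
    x.1 + y.1 = 3 * 2 ^ n

/-- Vertices of the last column joined by an arc on the right of the grid. -/
def RightArc (k p : ℕ) (x y : ℕ × ℕ) : Prop := x.2 = p ∧ y.2 = p ∧ x.1 + y.1 = 2 ^ k

/-- The grid with `2 ^ k - 1` rows and `p` columns, given as pairs (row, column), with additional
planar arcs on its left and right; it is a planar drawing of `G_{k,p}`. -/
def foldGraph (k p : ℕ) : SimpleGraph (ℕ × ℕ) where
  Adj x y := InGrid k p x ∧ InGrid k p y ∧ x ≠ y ∧
    ((x.2 = y.2 ∧ (x.1 + 1 = y.1 ∨ y.1 + 1 = x.1)) ∨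
      (x.1 = y.1 ∧ (x.2 + 1 = y.2 ∨ y.2 + 1 = x.2)) ∨ RightArc k p x y ∨ LeftArc x y)
  symm := ⟨by
    rintro x y ⟨hx, hy, hne, h⟩
    refine ⟨hy, hx, hne.symm, ?_⟩
    rcases h with ⟨h, h'⟩ | ⟨h, h'⟩ | ⟨h1, h2, h3⟩ | ⟨h1, h2, n, h⟩
    · exact Or.inl ⟨h.symm, h'.symm⟩
    · exact Or.inr (Or.inl ⟨h.symm, h'.symm⟩)
    · exact Or.inr (Or.inr (Or.inl ⟨h2, h1, by omega⟩))
    · exact Or.inr (Or.inr (Or.inr ⟨h2, h1, n, by omega⟩))⟩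
  loopless := ⟨fun x h => h.2.2.1 rfl⟩

/-- The edge `xy` crosses the upward ray that starts slightly to the right of `v`. -/
def CrossesRay (k p : ℕ) (x y v : ℕ × ℕ) : Prop :=
  (x.1 = y.1 ∧ x.1 < v.1 ∧ ((x.2 = v.2 ∧ y.2 = v.2 + 1) ∨ (y.2 = v.2 ∧ x.2 = v.2 + 1))) ∨
    (v.2 = p ∧ RightArc k p x y ∧ ((x.1 < v.1 ∧ v.1 ≤ y.1) ∨ (y.1 < v.1 ∧ v.1 ≤ x.1)))

lemma two_pow_ne_three_mul (k n : ℕ) : 2 ^ k ≠ 3 * 2 ^ n := by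
  intro h
  have h3 : 3 ∣ 2 ^ k := ⟨_, h⟩
  have := Nat.prime_three.dvd_of_dvd_pow h3
  omega

lemma two_pow_trichotomy (m n : ℕ) :
    2 ^ m = 2 ^ n ∨ 2 ^ (m + 1) ≤ 2 ^ n ∨ 2 ^ (n + 1) ≤ 2 ^ m := by
  rcases lt_trichotomy m n with h | h | h
  · exact Or.inr (Or.inl (Nat.pow_le_pow_right (by norm_num) h))
  · exact Or.inl (by rw [h])
  · exact Or.inr (Or.inr (Nat.pow_le_pow_right (by norm_num) h))

lemma not_crossesRay_of_vertical {k p r c : ℕ} (hk : 1 ≤ k) (v : ℕ × ℕ) :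
    ¬ CrossesRay k p (r, c) (r + 1, c) v := by
  obtain ⟨k, rfl⟩ : ∃ m, k = m + 1 := ⟨k - 1, by omega⟩
  have := pow_succ 2 k
  simp only [CrossesRay, RightArc]
  omega

lemma crossesRay_of_horizontal {k p r c : ℕ} (hc : c + 1 ≤ p) (v : ℕ × ℕ) :
    CrossesRay k p (r, c) (r, c + 1) v ↔ v.2 = c ∧ r < v.1 := by
  simp only [CrossesRay, RightArc]
  grind

lemma crossesRay_of_rightArc {k p r s : ℕ} (hrs : r < s) (h : r + s = 2 ^ k) (v : ℕ × ℕ) :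
    CrossesRay k p (r, p) (s, p) v ↔ v.2 = p ∧ r < v.1 ∧ v.1 ≤ s := by
  simp only [CrossesRay, RightArc]
  grind

lemma not_crossesRay_of_leftArc {k p n r s : ℕ} (h : r + s = 3 * 2 ^ n) (v : ℕ × ℕ) :
    ¬ CrossesRay k p (r, 1) (s, 1) v := by
  have := two_pow_ne_three_mul k n
  simp only [CrossesRay, RightArc]
  omega

lemma crossesRay_comm {k p : ℕ} (x y v : ℕ × ℕ) :
    CrossesRay k p x y v ↔ CrossesRay k p y x v := by
  simp only [CrossesRay, RightArc]
  omega

/-- To prove a symmetric statement about the edges of `foldGraph k p`, it suffices to treat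
each type of edges in one orientation. -/
lemma foldGraph_edge_induction {k p : ℕ} {Q : ℕ × ℕ → ℕ × ℕ → Prop}
    (symm : ∀ x y, Q x y → Q y x)
    (vertical : ∀ r c, 1 ≤ r → r + 1 < 2 ^ k → 1 ≤ c → c ≤ p → Q (r, c) (r + 1, c))
    (horizontal : ∀ r c, 1 ≤ r → r < 2 ^ k → 1 ≤ c → c + 1 ≤ p → Q (r, c) (r, c + 1))
    (right : ∀ r s, 1 ≤ r → r < s → r + s = 2 ^ k → 1 ≤ p → Q (r, p) (s, p))
    (left : ∀ n r s, 2 ^ n < r → r < s → s < 2 ^ (n + 1) → r + s = 3 * 2 ^ n →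
      s < 2 ^ k → 1 ≤ p → Q (r, 1) (s, 1))
    {x y : ℕ × ℕ} (h : (foldGraph k p).Adj x y) : Q x y := by
  obtain ⟨x1, x2⟩ := x
  obtain ⟨y1, y2⟩ := y
  obtain ⟨⟨a1, a2, a3, a4⟩, ⟨b1, b2, b3, b4⟩, hne, h⟩ := h
  simp only [Prod.mk.injEq, ne_eq, RightArc, LeftArc] at *
  rcases h with ⟨rfl, rfl | rfl⟩ | ⟨rfl, rfl | rfl⟩ | ⟨rfl, rfl, h⟩ | ⟨rfl, rfl, n, h⟩
  · exact vertical _ _ a1 b2 a3 a4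
  · exact symm _ _ (vertical _ _ b1 a2 a3 a4)
  · exact horizontal _ _ a1 b2 a3 b4
  · exact symm _ _ (horizontal _ _ a1 b2 b3 a4)
  · rcases lt_or_gt_of_ne (show x1 ≠ y1 by simpa using hne) with hlt | hlt
    · exact right _ _ a1 hlt h a3
    · exact symm _ _ (right _ _ b1 hlt (by omega) a3)
  · rcases lt_or_gt_of_ne (show x1 ≠ y1 by simpa using hne) with hlt | hlt
    · exact left n _ _ (by omega) hlt (by omega) (by omega) b2 a4
    · exact symm _ _ (left n _ _ (by omega) hlt (by omega) (by omega) a2 a4)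

/-- A change of colour between `u` and `v`, as seen by the edges avoiding `Z`, is governed by
the potential `g`. -/
def GovernedBy (k p : ℕ) (u v : ℕ × ℕ) (Z : Set (ℕ × ℕ)) (g : ℕ × ℕ → Prop) : Prop :=
  ∀ x y, (foldGraph k p).Adj x y → x ∉ Z → y ∉ Z →
    ((CrossesRay k p x y u ↔ CrossesRay k p x y v) ↔ (g x ↔ g y))

lemma GovernedBy.symm {k p : ℕ} {u v : ℕ × ℕ} {g : ℕ × ℕ → Prop}
    (h : GovernedBy k p u v {u, v} g) : GovernedBy k p v u {v, u} g := by
  intro x y hxy hx hy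
  rw [Set.pair_comm] at hx hy
  rw [← h x y hxy hx hy]
  exact iff_comm

lemma governedBy_of_edges {k p : ℕ} (hk : 1 ≤ k) {u v : ℕ × ℕ} {Z : Set (ℕ × ℕ)}
    {g : ℕ × ℕ → Prop}
    (vertical : ∀ r c, 1 ≤ r → r + 1 < 2 ^ k → 1 ≤ c → c ≤ p → (r, c) ∉ Z → (r + 1, c) ∉ Z →
      (g (r, c) ↔ g (r + 1, c)))
    (horizontal : ∀ r c, 1 ≤ r → r < 2 ^ k → 1 ≤ c → c + 1 ≤ p → (r, c) ∉ Z → (r, c + 1) ∉ Z →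
      (((u.2 = c ∧ r < u.1) ↔ (v.2 = c ∧ r < v.1)) ↔ (g (r, c) ↔ g (r, c + 1))))
    (right : ∀ r s, 1 ≤ r → r < s → r + s = 2 ^ k → 1 ≤ p → (r, p) ∉ Z → (s, p) ∉ Z →
      (((u.2 = p ∧ r < u.1 ∧ u.1 ≤ s) ↔ (v.2 = p ∧ r < v.1 ∧ v.1 ≤ s)) ↔
        (g (r, p) ↔ g (s, p))))
    (left : ∀ n r s, 2 ^ n < r → r < s → s < 2 ^ (n + 1) → r + s = 3 * 2 ^ n → s < 2 ^ k → 1 ≤ p →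
      (r, 1) ∉ Z → (s, 1) ∉ Z → (g (r, 1) ↔ g (s, 1))) :
    GovernedBy k p u v Z g := by
  intro x y h
  refine foldGraph_edge_induction (Q := fun x y => x ∉ Z → y ∉ Z →
    ((CrossesRay k p x y u ↔ CrossesRay k p x y v) ↔ (g x ↔ g y))) ?_ ?_ ?_ ?_ ?_ h
  · intro x y h h1 h2
    rw [crossesRay_comm y x, crossesRay_comm y x, h h2 h1]
    exact iff_comm
  · intro r c h1 h2 h3 h4 h5 h6
    simp only [not_crossesRay_of_vertical hk, true_iff]
    exact vertical r c h1 h2 h3 h4 h5 h6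
  · intro r c h1 h2 h3 h4 h5 h6
    simp only [crossesRay_of_horizontal h4]
    exact horizontal r c h1 h2 h3 h4 h5 h6
  · intro r s h1 h2 h3 h4 h5 h6
    simp only [crossesRay_of_rightArc h2 h3]
    exact right r s h1 h2 h3 h4 h5 h6
  · intro n r s h1 h2 h3 h4 h5 h6 h7 h8
    simp only [not_crossesRay_of_leftArc h4, true_iff]
    exact left n r s h1 h2 h3 h4 h5 h6 h7 h8

lemma governedBy_rightArc {k p : ℕ} (hk : 1 ≤ k) {r s : ℕ} (h : r + s = 2 ^ k) :
    GovernedBy k p (r, p) (s, p) {(r, p), (s, p)} (fun _ => False) := by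
  obtain ⟨k, rfl⟩ : ∃ m, k = m + 1 := ⟨k - 1, by omega⟩
  have := pow_succ 2 k
  apply governedBy_of_edges hk
  all_goals
    simp only [Set.mem_insert_iff, Set.mem_singleton_iff, Prod.mk.injEq]
    grind

lemma governedBy_vertical {k p : ℕ} (hk : 1 ≤ k) (r c : ℕ) :
    GovernedBy k p (r, c) (r + 1, c) {(r, c), (r + 1, c)} (fun _ => False) := by
  obtain ⟨k, rfl⟩ : ∃ m, k = m + 1 := ⟨k - 1, by omega⟩
  have := pow_succ 2 k
  apply governedBy_of_edges hk
  all_goals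
    simp only [Set.mem_insert_iff, Set.mem_singleton_iff, Prod.mk.injEq]
    grind

lemma governedBy_horizontal {k p : ℕ} (hk : 1 ≤ k) {r c : ℕ} (hr : r < 2 ^ k) (hc : 1 ≤ c)
    (hcp : c + 1 ≤ p) :
    GovernedBy k p (r, c) (r, c + 1) {(r, c), (r, c + 1)} (fun x => x.2 = c + 1 ∧ x.1 < r) := by
  obtain ⟨k, rfl⟩ : ∃ m, k = m + 1 := ⟨k - 1, by omega⟩
  have := pow_succ 2 k
  apply governedBy_of_edges hk
  all_goals
    simp only [Set.mem_insert_iff, Set.mem_singleton_iff, Prod.mk.injEq]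
    grind

lemma governedBy_leftArc {k p : ℕ} (hk : 1 ≤ k) {n r s : ℕ} (hr : 2 ^ n < r)
    (hrs : r < s) (hs : s < 2 ^ (n + 1)) (hsum : r + s = 3 * 2 ^ n) (hsk : s < 2 ^ k) :
    GovernedBy k p (r, 1) (s, 1) {(r, 1), (s, 1)} (fun x => x.2 = 1 ∧ r < x.1 ∧ x.1 < s) := by
  obtain ⟨k, rfl⟩ : ∃ m, k = m + 1 := ⟨k - 1, by omega⟩
  have := pow_succ 2 k
  have := pow_succ 2 n
  have := two_pow_ne_three_mul (k + 1) n
  refine governedBy_of_edges hk ?_ ?_ ?_ ?_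
  · simp only [Set.mem_insert_iff, Set.mem_singleton_iff, Prod.mk.injEq]
    grind
  · simp only [Set.mem_insert_iff, Set.mem_singleton_iff, Prod.mk.injEq]
    grind
  · simp only [Set.mem_insert_iff, Set.mem_singleton_iff, Prod.mk.injEq]
    grind
  · simp only [Set.mem_insert_iff, Set.mem_singleton_iff, Prod.mk.injEq]
    intro m r s
    have := two_pow_trichotomy m n
    have := pow_succ 2 m
    grind

lemma governedBy_terminals {k p : ℕ} (hk : 1 ≤ k) {n : ℕ} (hnk : n + 1 < k) :
    GovernedBy k p (2 ^ n, 1) (3 * 2 ^ n, 1)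
      ({(2 ^ n, 1), (3 * 2 ^ n, 1)} ∪ {x | x.2 = 1 ∧ 3 * 2 ^ n < x.1 ∧ x.1 < 2 ^ (n + 2)})
      (fun x => x.2 = 1 ∧ 2 ^ n < x.1 ∧ x.1 < 3 * 2 ^ n) := by
  obtain ⟨k, rfl⟩ : ∃ m, k = m + 1 := ⟨k - 1, by omega⟩
  have := pow_succ 2 k
  have := pow_succ 2 n
  have := pow_succ 2 (n + 1)
  have := two_pow_ne_three_mul (k + 1) n
  have := Nat.pow_le_pow_right (n := 2) (by norm_num) (show n + 1 ≤ k by omega)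
  refine governedBy_of_edges hk ?_ ?_ ?_ ?_
  · simp only [Set.mem_union, Set.mem_insert_iff, Set.mem_singleton_iff, Prod.mk.injEq,
      Set.mem_ofPred_eq]
    grind
  · simp only [Set.mem_union, Set.mem_insert_iff, Set.mem_singleton_iff, Prod.mk.injEq,
      Set.mem_ofPred_eq]
    grind
  · simp only [Set.mem_union, Set.mem_insert_iff, Set.mem_singleton_iff, Prod.mk.injEq,
      Set.mem_ofPred_eq]
    intro r s
    rcases eq_or_ne p 1 with rfl | hp <;> grind
  · simp only [Set.mem_union, Set.mem_insert_iff, Set.mem_singleton_iff, Prod.mk.injEq,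
      Set.mem_ofPred_eq]
    intro m r s
    have := two_pow_trichotomy m n
    have := pow_succ 2 m
    have := two_pow_trichotomy m (n + 1)
    grind

/-- A potential governing the change of colour along the edge `uv`, which moreover does not change
along segments of columns avoiding `u` and `v`. -/
structure IsPotential (k p : ℕ) (u v : ℕ × ℕ) (g : ℕ × ℕ → Prop) : Prop where
  governedBy : GovernedBy k p u v {u, v} g
  column : ∀ a b i, (∀ r, StrictBtw a b r → (r, i) ≠ u ∧ (r, i) ≠ v) → (a, i) ≠ u → (a, i) ≠ v →
    (b, i) ≠ u → (b, i) ≠ v → (g (a, i) ↔ g (b, i))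
  source : ∀ n, ¬ g (2 ^ n, 1)
  upper : ∀ i, 1 ≤ i → (g (0, i) ↔ ¬ (i ≤ u.2 ↔ i ≤ v.2))
  lower : ∀ i, ¬ g (2 ^ k, i)

lemma IsPotential.symm {k p : ℕ} {u v : ℕ × ℕ} {g : ℕ × ℕ → Prop} (h : IsPotential k p u v g) :
    IsPotential k p v u g where
  governedBy := h.governedBy.symm
  column a b i h1 h2 h3 h4 h5 := h.column a b i (fun r hr => (h1 r hr).symm) h3 h2 h5 h4
  source := h.source
  upper i hi := by rw [h.upper i hi]; tauto
  lower := h.lower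

lemma exists_isPotential {k p : ℕ} (hk : 1 ≤ k) {u v : ℕ × ℕ} (h : (foldGraph k p).Adj u v) :
    ∃ g, IsPotential k p u v g := by
  refine foldGraph_edge_induction (Q := fun u v => ∃ g, IsPotential k p u v g) ?_ ?_ ?_ ?_ ?_ h
  · rintro u v ⟨g, hg⟩
    exact ⟨g, hg.symm⟩
  · intro r c _ _ _ _
    exact ⟨_, governedBy_vertical hk r c, by simp, by simp, by simp, by simp⟩
  · intro r c hr hrk hc hcp
    refine ⟨_, governedBy_horizontal hk hrk hc hcp, ?_, ?_, ?_, ?_⟩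
    · intro a b i hs
      have := hs r
      simp only [StrictBtw] at *
      grind
    · intro n
      simp only
      omega
    · intro i hi
      simp only
      omega
    · intro i
      simp only
      omega
  · intro r s _ _ h _
    exact ⟨_, governedBy_rightArc hk h, by simp, by simp, by simp, by simp⟩
  · intro n r s hr hrs hs hsum hsk hp
    refine ⟨_, governedBy_leftArc hk hr hrs hs hsum hsk, ?_, ?_, ?_, ?_⟩
    · intro a b i hs
      have h1 := hs r
      have h2 := hs s
      simp only [StrictBtw] at *
      grind
    · intro m
      have := two_pow_trichotomy m n
      have := pow_succ 2 n
      have := pow_succ 2 m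
      simp only
      omega
    · simp
    · intro i
      simp only
      omega

/-- The parity of the number of edges of a walk crossing the ray of `v`; `True` means even. -/
def evenCrossings (k p : ℕ) (v : ℕ × ℕ) : ∀ {x y}, (foldGraph k p).Walk x y → Prop
  | _, _, .nil => True
  | _, _, .cons (u := x) (v := y) _ w => ¬ (CrossesRay k p x y v ↔ evenCrossings k p v w)

lemma GovernedBy.evenCrossings_iff {k p : ℕ} {u v : ℕ × ℕ} {Z : Set (ℕ × ℕ)} {g : ℕ × ℕ → Prop}
    (hg : GovernedBy k p u v Z g) {x y : ℕ × ℕ} (w : (foldGraph k p).Walk x y)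
    (hw : ∀ z ∈ w.support, z ∉ Z) :
    (evenCrossings k p u w ↔ evenCrossings k p v w) ↔ (g x ↔ g y) := by
  induction w with
  | nil => simp [evenCrossings]
  | @cons x y z h w ih =>
    have h1 := hg x y h (hw x (by simp)) (hw y (by simp))
    have h2 := ih (fun z hz => hw z (by simp [hz]))
    simp only [evenCrossings]
    grind

/-- A family of pairwise vertex-disjoint walks in `foldGraph k p` joining the terminal pairs. -/
structure FoldLinkage (k p : ℕ) where
  walk : ∀ j, j < k →
    (foldGraph k p).Walk (2 ^ j, 1) (if j + 1 = k then (2 ^ j, p) else (3 * 2 ^ j, 1))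
  disjoint : ∀ i j hi hj, i ≠ j → ∀ v ∈ (walk i hi).support, v ∉ (walk j hj).support

namespace FoldLinkage

variable {k p : ℕ} (L : FoldLinkage k p)

/-- The vertices of the `j`-th walk of a linkage. -/
def verts (j : ℕ) : Set (ℕ × ℕ) := {v | ∃ h : j < k, v ∈ (L.walk j h).support}

lemma notMem_verts {i j : ℕ} (hij : i ≠ j) {v : ℕ × ℕ} (h : v ∈ L.verts i) : v ∉ L.verts j :=
  fun ⟨hj, hv⟩ => L.disjoint i j h.1 hj hij v h.2 hv

lemma inGrid (hp : 1 ≤ p) {j : ℕ} {v : ℕ × ℕ} (h : v ∈ L.verts j) : InGrid k p v := by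
  obtain ⟨hj, hv⟩ := h
  have h0 : InGrid k p (2 ^ j, 1) :=
    ⟨Nat.one_le_two_pow, Nat.pow_lt_pow_right (by norm_num) hj, le_rfl, hp⟩
  have key : ∀ {x y} (w : (foldGraph k p).Walk x y), InGrid k p x → ∀ v ∈ w.support,
      InGrid k p v := by
    intro x y w
    induction w with
    | nil => simp
    | cons h w ih =>
      intro hx v hv
      rw [Walk.support_cons, List.mem_cons] at hv
      rcases hv with rfl | hv
      · exact hx
      · exact ih h.2.1 v hv
  exact key _ h0 v hv

lemma exists_walk {j : ℕ} {x : ℕ × ℕ} (h : x ∈ L.verts j) :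
    ∃ w : (foldGraph k p).Walk (2 ^ j, 1) x, ∀ z ∈ w.support, z ∈ L.verts j := by
  classical
  obtain ⟨hj, hx⟩ := h
  exact ⟨(L.walk j hj).takeUntil x hx,
    fun z hz => ⟨hj, Walk.support_takeUntil_subset_support _ hx hz⟩⟩

/-- A function changing along the edges of the `j`-th walk and between its ends as the parity of
crossings of a walk ending in `x` does. -/
def IsColouring (j : ℕ) (x : ℕ × ℕ) (f : ℕ × ℕ → Prop) (flip : Prop) : Prop :=
  (∀ u ∈ L.verts j, ∀ v ∈ L.verts j, ∀ g, IsPotential k p u v g → ((f u ↔ f v) ↔ ¬ g x)) ∧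
    ((f (2 ^ j, 1) ↔ f (3 * 2 ^ j, 1)) ↔ (flip ↔ (x.2 = 1 ∧ 2 ^ j < x.1 ∧ x.1 < 3 * 2 ^ j)))

/-- The walks of index `> j` avoid the left arcs around the `j`-th target. -/
def ArcsAvoided (j : ℕ) : Prop :=
  ∀ m, j < m → ∀ r, 3 * 2 ^ j < r → r < 2 ^ (j + 2) → (r, 1) ∉ L.verts m

/-- `x` lies on a walk of index greater than `j`, or in the row above or below the grid. -/
def IsBarrier (j : ℕ) (x : ℕ × ℕ) : Prop := x.1 = 0 ∨ x.1 = 2 ^ k ∨ ∃ m, j < m ∧ x ∈ L.verts m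

variable {L}

lemma source_mem {j : ℕ} (hj : j < k) : (2 ^ j, 1) ∈ L.verts j := ⟨hj, Walk.start_mem_support _⟩

lemma target_mem {j : ℕ} (hj : j + 1 < k) : (3 * 2 ^ j, 1) ∈ L.verts j := by
  refine ⟨by omega, ?_⟩
  have key : ∀ y, (if j + 1 = k then (2 ^ j, p) else (3 * 2 ^ j, 1)) = y →
      y ∈ (L.walk j (by omega)).support := by
    rintro _ rfl
    exact Walk.end_mem_support _
  exact key _ (if_neg (by omega))

lemma exists_isColouring {j m : ℕ} (hjm : j < m) (hA : L.ArcsAvoided j) {x : ℕ × ℕ}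
    (hx : x ∈ L.verts m) : ∃ f, L.IsColouring j x f (m = j + 1) := by
  obtain ⟨w, hw⟩ := L.exists_walk hx
  have hm : m < k := hx.1
  refine ⟨fun v => evenCrossings k p v w, ?_, ?_⟩
  · intro u hu v hv g hg
    rw [hg.governedBy.evenCrossings_iff w]
    · have := hg.source m
      tauto
    · rintro z hz (rfl | rfl)
      · exact L.notMem_verts hjm.ne hu (hw _ hz)
      · exact L.notMem_verts hjm.ne hv (hw _ hz)
  · rw [(governedBy_terminals (by omega) (by omega)).evenCrossings_iff w]
    · have h1 : 2 ^ (j + 1) = 2 * 2 ^ j := by ring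
      have h2 : 2 ^ (j + 2) = 4 * 2 ^ j := by ring
      have := Nat.two_pow_pos j
      have : 2 ^ j < 2 ^ m ∧ 2 ^ m < 3 * 2 ^ j ↔ m = j + 1 := by
        constructor
        · intro h
          by_contra hne
          have := Nat.pow_le_pow_right (n := 2) (by norm_num) (show j + 2 ≤ m by omega)
          omega
        · rintro rfl
          omega
      simp only [true_and, this]
    · rintro z hz ((rfl | rfl) | ⟨h1, h2, h3⟩)
      · exact L.notMem_verts hjm.ne (source_mem (by omega)) (hw _ hz)
      · exact L.notMem_verts hjm.ne (target_mem (by omega)) (hw _ hz)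
      · obtain ⟨z1, z2⟩ := z
        simp only at h1 h2 h3
        subst h1
        exact hA m hjm _ h2 h3 (hw _ hz)

lemma IsBarrier.exists_isColouring {j : ℕ} (hj : j + 1 < k) (hA : L.ArcsAvoided j) {b i : ℕ}
    (hi : 1 ≤ i) (hb : L.IsBarrier (j + 1) (b, i)) : ∃ f, L.IsColouring j (b, i) f False := by
  rcases hb with h | h | ⟨m, hm, h⟩
  · simp only at h
    subst h
    refine ⟨fun v => i ≤ v.2, fun u _ v _ g hg => ?_, by simp⟩
    rw [hg.upper i hi, not_not]
  · simp only at h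
    subst h
    have := Nat.pow_le_pow_right (n := 2) (by norm_num) (show j + 2 ≤ k by omega)
    have h2 : 2 ^ (j + 2) = 4 * 2 ^ j := by ring
    have := Nat.two_pow_pos j
    refine ⟨fun v => True, fun u _ v _ g hg => by simp [hg.lower i], ?_⟩
    simp only [true_iff, false_iff]
    omega
  · have hne : m ≠ j + 1 := by omega
    simpa [hne] using FoldLinkage.exists_isColouring (show j < m by omega) hA h

lemma IsBarrier.notMem (hp : 1 ≤ p) {j : ℕ} {x : ℕ × ℕ} (h : L.IsBarrier j x) {l : ℕ}
    (hl : l ≤ j) : x ∉ L.verts l := by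
  intro hx
  have := L.inGrid hp hx
  rcases h with h | h | ⟨m, hm, h⟩
  · exact absurd this.1 (by omega)
  · exact absurd this.2.1 (by omega)
  · exact L.notMem_verts (by omega) h hx

/-- The `j`-th walk crosses each segment of a column between the walk `j + 1` and a barrier. -/
lemma exists_mem_between (hp : 1 ≤ p) {j a b i : ℕ} (hA : L.ArcsAvoided j)
    (ha : (a, i) ∈ L.verts (j + 1)) (hb : L.IsBarrier (j + 1) (b, i)) :
    ∃ r, StrictBtw a b r ∧ (r, i) ∈ L.verts j := by
  by_contra! hno
  have hj : j + 1 < k := ha.1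
  have ha' := L.notMem_verts (show j + 1 ≠ j by omega) ha
  have hb' := hb.notMem hp (show j ≤ j + 1 by omega)
  obtain ⟨f₁, hf₁, hf₁'⟩ := exists_isColouring (show j < j + 1 by omega) hA ha
  obtain ⟨f₂, hf₂, hf₂'⟩ := hb.exists_isColouring hj hA (L.inGrid hp ha).2.2.1
  have hstep : ∀ {x y} (w : (foldGraph k p).Walk x y), (∀ z ∈ w.support, z ∈ L.verts j) →
      ((f₁ x ↔ f₂ x) ↔ (f₁ y ↔ f₂ y)) := by
    intro x y w
    induction w with
    | nil => simp
    | @cons x y z h w ih =>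
      intro hw
      rw [← ih (fun z hz => hw z (by simp [hz]))]
      have hx := hw x (by simp)
      have hy := hw y (by simp)
      obtain ⟨g, hg⟩ := exists_isPotential (by omega) h
      have h1 := hf₁ x hx y hy g hg
      have h2 := hf₂ x hx y hy g hg
      have hne : ∀ {c z : ℕ × ℕ}, c ∉ L.verts j → z ∈ L.verts j → c ≠ z := by
        rintro c _ hc hz rfl
        exact hc hz
      have h3 := hg.column a b i (fun r hr => ⟨hne (hno r hr) hx, hne (hno r hr) hy⟩)
        (hne ha' hx) (hne ha' hy) (hne hb' hx) (hne hb' hy)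
      grind
  obtain ⟨w, hw⟩ := L.exists_walk (target_mem (L := L) hj)
  have h0 := hstep w hw
  have hcol : (i = 1 ∧ 2 ^ j < a ∧ a < 3 * 2 ^ j) ↔ (i = 1 ∧ 2 ^ j < b ∧ b < 3 * 2 ^ j) := by
    refine and_congr_right ?_
    rintro rfl
    have hs := source_mem (L := L) (show j < k by omega)
    have ht := target_mem (L := L) hj
    have h1 : a ≠ 2 ^ j := by rintro rfl; exact ha' hs
    have h2 : a ≠ 3 * 2 ^ j := by rintro rfl; exact ha' ht
    have h3 : b ≠ 2 ^ j := by rintro rfl; exact hb' hs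
    have h4 : b ≠ 3 * 2 ^ j := by rintro rfl; exact hb' ht
    have h5 : ¬ StrictBtw a b (2 ^ j) := fun h => hno _ h hs
    have h6 : ¬ StrictBtw a b (3 * 2 ^ j) := fun h => hno _ h ht
    simp only [StrictBtw] at h5 h6
    omega
  simp only at hf₁' hf₂'
  grind

/-- Between walk `j` and a barrier, each column contains `2 ^ j - 1` vertices of lower walks. -/
def Dense (L : FoldLinkage k p) (j : ℕ) : Prop :=
  ∀ a b i, (a, i) ∈ L.verts j → L.IsBarrier j (b, i) →
    ∃ T : Finset ℕ, T.card = 2 ^ j - 1 ∧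
      ∀ r ∈ T, StrictBtw a b r ∧ ∃ l, l < j ∧ (r, i) ∈ L.verts l

lemma Dense.arcsAvoided {j : ℕ} (h : L.Dense j) (hj : j + 1 < k) : L.ArcsAvoided j := by
  intro m hm r hr1 hr2 hrm
  have hb : L.IsBarrier j (2 ^ (j + 2), 1) := by
    rcases eq_or_ne (j + 2) k with rfl | hne
    · exact Or.inr (Or.inl rfl)
    · exact Or.inr (Or.inr ⟨j + 2, by omega, source_mem (by omega)⟩)
  obtain ⟨T, hT, hT'⟩ := h _ _ _ (target_mem hj) hb
  have h2 : 2 ^ (j + 2) = 4 * 2 ^ j := by ring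
  have hsub : T ⊆ Finset.Ioo (3 * 2 ^ j) (2 ^ (j + 2)) := by
    intro r hr
    have := (hT' r hr).1
    simp only [StrictBtw] at this
    rw [Finset.mem_Ioo]
    omega
  have heq := Finset.eq_of_subset_of_card_le hsub (by rw [Nat.card_Ioo]; omega)
  obtain ⟨l, hl, hlm⟩ := (hT' r (heq ▸ Finset.mem_Ioo.2 ⟨hr1, hr2⟩)).2
  exact L.notMem_verts (by omega) hlm hrm

lemma exists_finset_of_dense {j a b c i : ℕ} (h : L.Dense j) (hc : (c, i) ∈ L.verts j)
    (hcab : StrictBtw a b c) (ha : L.IsBarrier j (a, i)) (hb : L.IsBarrier j (b, i)) :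
    ∃ T : Finset ℕ, T.card = 2 ^ (j + 1) - 1 ∧
      ∀ r ∈ T, StrictBtw a b r ∧ ∃ l, l < j + 1 ∧ (r, i) ∈ L.verts l := by
  obtain ⟨T₁, hT₁, h₁⟩ := h c a i hc ha
  obtain ⟨T₂, hT₂, h₂⟩ := h c b i hc hb
  have hd : Disjoint T₁ T₂ := by
    rw [Finset.disjoint_left]
    intro r hr1 hr2
    have := (h₁ r hr1).1
    have := (h₂ r hr2).1
    simp only [StrictBtw] at *
    omega
  have hcT : c ∉ T₁ ∪ T₂ := by
    rw [Finset.mem_union]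
    rintro (hr | hr)
    · have := (h₁ c hr).1
      simp only [StrictBtw] at this
      omega
    · have := (h₂ c hr).1
      simp only [StrictBtw] at this
      omega
  refine ⟨insert c (T₁ ∪ T₂), ?_, ?_⟩
  · rw [Finset.card_insert_of_notMem hcT, Finset.card_union_of_disjoint hd, hT₁, hT₂]
    have := pow_succ 2 j
    have := Nat.one_le_two_pow (n := j)
    omega
  · intro r hr
    rw [Finset.mem_insert, Finset.mem_union] at hr
    rcases hr with rfl | hr | hr
    · exact ⟨hcab, j, by omega, hc⟩
    · obtain ⟨h3, l, hl, hl'⟩ := h₁ r hr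
      refine ⟨?_, l, by omega, hl'⟩
      simp only [StrictBtw] at *
      omega
    · obtain ⟨h3, l, hl, hl'⟩ := h₂ r hr
      refine ⟨?_, l, by omega, hl'⟩
      simp only [StrictBtw] at *
      omega

lemma IsBarrier.mono {i j : ℕ} (hij : i ≤ j) {x : ℕ × ℕ} (h : L.IsBarrier j x) :
    L.IsBarrier i x := by
  rcases h with h | h | ⟨m, hm, h⟩
  · exact Or.inl h
  · exact Or.inr (Or.inl h)
  · exact Or.inr (Or.inr ⟨m, by omega, h⟩)

lemma dense (hp : 1 ≤ p) (L : FoldLinkage k p) (j : ℕ) : L.Dense j := by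
  induction j with
  | zero => exact fun _ _ _ _ _ => ⟨∅, by simp, by simp⟩
  | succ j ih =>
    intro a b i ha hb
    obtain ⟨c, hc, hcj⟩ := exists_mem_between hp (ih.arcsAvoided ha.1) ha hb
    exact exists_finset_of_dense ih hcj hc (Or.inr (Or.inr ⟨j + 1, by omega, ha⟩))
      (hb.mono (by omega))

/-- The walk of the last terminal pair meets every column. -/
lemma exists_mem_column (L : FoldLinkage k p) (hk : 1 ≤ k) {i : ℕ} (hi : 1 ≤ i) (hip : i ≤ p) :
    ∃ r, (r, i) ∈ L.verts (k - 1) := by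
  have key : ∀ {x y} (w : (foldGraph k p).Walk x y), x.2 ≤ i → i ≤ y.2 →
      ∃ z ∈ w.support, z.2 = i := by
    intro x y w
    induction w with
    | @nil x => exact fun h1 h2 => ⟨x, by simp, by omega⟩
    | @cons x y z h w ih =>
      intro h1 h2
      rcases Nat.lt_or_ge i y.2 with hlt | hge
      · refine ⟨x, by simp, ?_⟩
        rcases h.2.2.2 with h | h | ⟨h, h', _⟩ | ⟨h, h', _⟩ <;> omega
      · obtain ⟨z, hz, hz'⟩ := ih hge h2
        exact ⟨z, by simp [hz], hz'⟩
  have hw := key (L.walk (k - 1) (by omega)) hi (by rw [if_pos (by omega)]; exact hip)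
  obtain ⟨⟨r, c⟩, hz, rfl⟩ := hw
  exact ⟨r, by omega, hz⟩

/-- A linkage covers the whole grid. -/
theorem exists_mem_verts (L : FoldLinkage k p) (hk : 1 ≤ k) (hp : 1 ≤ p) {v : ℕ × ℕ}
    (hv : InGrid k p v) : ∃ l, v ∈ L.verts l := by
  obtain ⟨r, i⟩ := v
  obtain ⟨h1, h2, h3, h4⟩ := hv
  obtain ⟨c, hc⟩ := L.exists_mem_column hk h3 h4
  have hcg := L.inGrid hp hc
  obtain ⟨T, hT, hT'⟩ := exists_finset_of_dense (a := 0) (b := 2 ^ k) (L.dense hp (k - 1)) hc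
    (Or.inl ⟨hcg.1, hcg.2.1⟩) (Or.inl rfl) (Or.inr (Or.inl rfl))
  rw [Nat.sub_add_cancel hk] at hT
  have hsub : T ⊆ Finset.Ioo 0 (2 ^ k) := by
    intro r hr
    have := (hT' r hr).1
    simp only [StrictBtw] at this
    rw [Finset.mem_Ioo]
    omega
  have heq := Finset.eq_of_subset_of_card_le hsub (by rw [Nat.card_Ioo]; omega)
  obtain ⟨l, -, hl⟩ := (hT' r (heq ▸ Finset.mem_Ioo.2 ⟨h1, h2⟩)).2
  exact ⟨l, hl⟩

end FoldLinkage

/-- `c` draws a rowed graph with `k` terminal pairs in `foldGraph k p`. -/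
structure RowedGraph.IsDrawing {p : ℕ} (R : RowedGraph p) (k : ℕ) (c : R.V → ℕ × ℕ) : Prop where
  injective : Function.Injective c
  inGrid : ∀ v, InGrid k p (c v)
  top : ∀ i, c (R.top i) = (1, i.val + 1)
  bot : ∀ i, c (R.bot i) = (2 ^ k - 1, i.val + 1)
  source : ∀ j, j < k → c (R.s j) = (2 ^ j, 1)
  target : ∀ j, j < k → c (R.t j) = if j + 1 = k then (2 ^ j, p) else (3 * 2 ^ j, 1)
  adj : ∀ u v, R.G.Adj u v → (foldGraph k p).Adj (c u) (c v)

/-- Folds the right half of a grid with `2 * p` columns below its left half. -/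
def foldCoord (k p : ℕ) (x : ℕ × ℕ) : ℕ × ℕ :=
  if x.2 ≤ p then x else (2 ^ (k + 1) - x.1, 2 * p + 1 - x.2)

lemma foldCoord_of_le {k p r c : ℕ} (h : c ≤ p) : foldCoord k p (r, c) = (r, c) := if_pos h

lemma foldCoord_of_lt {k p r c : ℕ} (h : p < c) :
    foldCoord k p (r, c) = (2 ^ (k + 1) - r, 2 * p + 1 - c) := if_neg (Nat.not_le.2 h)

lemma foldCoord_ne {k p : ℕ} {x : ℕ × ℕ} (h : InGrid k (2 * p) x) :
    (foldCoord k p x).1 ≠ 2 ^ k := by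
  have := pow_succ 2 k
  obtain ⟨r, c⟩ := x
  simp only [InGrid, foldCoord] at *
  split_ifs <;> simp only <;> omega

lemma foldCoord_inGrid {k p : ℕ} {x : ℕ × ℕ} (h : InGrid k (2 * p) x) :
    InGrid (k + 1) p (foldCoord k p x) := by
  have := pow_succ 2 k
  obtain ⟨r, c⟩ := x
  simp only [InGrid, foldCoord] at *
  split_ifs <;> simp only <;> omega

lemma foldCoord_injOn (k p : ℕ) : Set.InjOn (foldCoord k p) {x | InGrid k (2 * p) x} := by
  rintro ⟨r, c⟩ h ⟨r', c'⟩ h' heq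
  have := pow_succ 2 k
  simp only [InGrid, foldCoord, Set.mem_ofPred_eq] at *
  split_ifs at heq <;> simp only [Prod.mk.injEq] at * <;> omega

lemma foldCoord_adj {k p : ℕ} {x y : ℕ × ℕ} (h : (foldGraph k (2 * p)).Adj x y) :
    (foldGraph (k + 1) p).Adj (foldCoord k p x) (foldCoord k p y) := by
  have hne : foldCoord k p x ≠ foldCoord k p y :=
    fun heq => h.ne (foldCoord_injOn k p h.1 h.2.1 heq)
  refine ⟨foldCoord_inGrid h.1, foldCoord_inGrid h.2.1, hne, ?_⟩
  clear hne
  have h2 := pow_succ 2 k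
  refine foldGraph_edge_induction (Q := fun x y => ((foldCoord k p x).2 = (foldCoord k p y).2 ∧
      ((foldCoord k p x).1 + 1 = (foldCoord k p y).1 ∨
        (foldCoord k p y).1 + 1 = (foldCoord k p x).1)) ∨
      ((foldCoord k p x).1 = (foldCoord k p y).1 ∧
        ((foldCoord k p x).2 + 1 = (foldCoord k p y).2 ∨
          (foldCoord k p y).2 + 1 = (foldCoord k p x).2)) ∨
      RightArc (k + 1) p (foldCoord k p x) (foldCoord k p y) ∨
      LeftArc (foldCoord k p x) (foldCoord k p y)) ?_ ?_ ?_ ?_ ?_ h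
  · rintro x y (⟨h, h'⟩ | ⟨h, h'⟩ | ⟨h1, h2, h3⟩ | ⟨h1, h2, n, h⟩)
    · exact Or.inl ⟨h.symm, h'.symm⟩
    · exact Or.inr (Or.inl ⟨h.symm, h'.symm⟩)
    · exact Or.inr (Or.inr (Or.inl ⟨h2, h1, by omega⟩))
    · exact Or.inr (Or.inr (Or.inr ⟨h2, h1, n, by omega⟩))
  · intro r c _ _ _ _
    refine Or.inl ?_
    rcases Nat.lt_or_ge p c with hc | hc
    · simp only [foldCoord_of_lt hc, true_and]
      omega
    · simp [foldCoord_of_le hc]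
  · intro r c _ _ _ _
    rcases lt_trichotomy p c with hc | rfl | hc
    · refine Or.inr (Or.inl ?_)
      simp only [foldCoord_of_lt hc, foldCoord_of_lt (Nat.lt_succ_of_lt hc), true_and]
      omega
    · refine Or.inr (Or.inr (Or.inl ?_))
      simp only [foldCoord_of_le le_rfl, foldCoord_of_lt (Nat.lt_add_one _), RightArc, true_and]
      omega
    · simp [foldCoord_of_le hc.le, foldCoord_of_le (Nat.succ_le_of_lt hc)]
  · intro r s _ _ _ _
    have hp : p < 2 * p := by omega
    refine Or.inr (Or.inr (Or.inr ?_))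
    simp only [foldCoord_of_lt hp, LeftArc]
    exact ⟨by omega, by omega, k, by omega⟩
  · intro n r s _ _ _ _ _ _
    have hp : 1 ≤ p := by omega
    refine Or.inr (Or.inr (Or.inr ?_))
    simp only [foldCoord_of_le hp, LeftArc]
    exact ⟨trivial, trivial, n, by omega⟩

lemma baseRG_isDrawing {p : ℕ} (hp : 0 < p) :
    (baseRG p hp).IsDrawing 1 (fun v : Fin p => (1, v.val + 1)) where
  injective u v h := by
    simp only [Prod.mk.injEq, true_and, Nat.add_right_cancel_iff] at h
    exact Fin.ext h
  inGrid v := ⟨le_rfl, by norm_num, by simp, v.isLt⟩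
  top _ := rfl
  bot _ := rfl
  source j hj := by
    obtain rfl : j = 0 := by omega
    rfl
  target j hj := by
    obtain rfl : j = 0 := by omega
    simp only [baseRG, zero_add, if_true, pow_zero, Prod.mk.injEq, true_and]
    omega
  adj u v h := by
    obtain ⟨hne, h⟩ := h
    refine ⟨⟨le_rfl, by norm_num, by simp, u.isLt⟩, ⟨le_rfl, by norm_num, by simp, v.isLt⟩, ?_,
      Or.inr (Or.inl ⟨rfl, ?_⟩)⟩
    · simpa using fun h => hne (Fin.ext h)
    · simp only
      omega

lemma stepRG_isDrawing {k p : ℕ} (hk : 1 ≤ k) (hp : 0 < p) {R : RowedGraph (2 * p)}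
    {c : R.V → ℕ × ℕ} (h : R.IsDrawing k c) : (stepRG k hp R).IsDrawing (k + 1)
      (Sum.elim (fun u => foldCoord k p (c u)) fun i => (2 ^ k, i.val + 1)) := by
  have h2 := pow_succ 2 k
  have hpos := Nat.two_pow_pos k
  have grid : ∀ i : Fin p, InGrid (k + 1) p (2 ^ k, i.val + 1) := fun i =>
    ⟨hpos, by omega, by simp, i.isLt⟩
  refine ⟨?_, ?_, ?_, ?_, ?_, ?_, ?_⟩
  · refine Function.Injective.sumElim ?_ ?_ ?_
    · exact fun u v huv => h.injective (foldCoord_injOn k p (h.inGrid u) (h.inGrid v) huv)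
    · intro i j hij
      simp only [Prod.mk.injEq, true_and, Nat.add_right_cancel_iff] at hij
      exact Fin.ext hij
    · exact fun u i heq => foldCoord_ne (h.inGrid u) (congrArg Prod.fst heq)
  · rintro (u | i)
    · exact foldCoord_inGrid (h.inGrid u)
    · exact grid i
  · intro i
    exact (congrArg _ (h.top _)).trans (foldCoord_of_le i.isLt)
  · intro i
    refine (congrArg _ (h.top _)).trans ((foldCoord_of_lt ?_).trans ?_)
    · simp only
      omega
    · simp only [Prod.mk.injEq, true_and]
      omega
  · intro j hj
    rcases Nat.lt_or_ge j k with hjk | hjk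
    · simp only [stepRG, if_pos hjk, Sum.elim_inl, h.source j hjk]
      exact foldCoord_of_le hp
    · obtain rfl : j = k := by omega
      simp [stepRG]
  · intro j hj
    rcases Nat.lt_or_ge j k with hjk | hjk
    · simp only [stepRG, if_pos hjk, Sum.elim_inl, h.target j hjk]
      rw [if_neg (show j + 1 ≠ k + 1 by omega)]
      split_ifs with hj'
      · subst hj'
        have h3 : 2 ^ (j + 1 + 1) = 4 * 2 ^ j := by ring
        rw [foldCoord_of_lt (by omega), Prod.mk.injEq]
        omega
      · exact foldCoord_of_le hp
    · obtain rfl : j = k := by omega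
      simp only [stepRG, lt_irrefl, if_false, Sum.elim_inr, if_true, Prod.mk.injEq, true_and]
      omega
  · have key : ∀ (i : Fin p) (v : R.V), (v = R.bot ⟨i.val, by omega⟩ ∨
        v = R.bot ⟨2 * p - 1 - i.val, by omega⟩) →
        (foldGraph (k + 1) p).Adj (2 ^ k, i.val + 1) (foldCoord k p (c v)) := by
      intro i v hv
      refine ⟨grid i, foldCoord_inGrid (h.inGrid v),
        fun heq => foldCoord_ne (h.inGrid v) (congrArg Prod.fst heq.symm), Or.inl ?_⟩
      rcases hv with rfl | rfl
      · rw [h.bot, foldCoord_of_le i.isLt]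
        simp only [true_and]
        omega
      · rw [h.bot, foldCoord_of_lt (by simp only; omega)]
        simp only
        omega
    have hor : ∀ i j : Fin p, i.val + 1 = j.val →
        (foldGraph (k + 1) p).Adj (2 ^ k, i.val + 1) (2 ^ k, j.val + 1) := fun i j hij =>
      ⟨grid i, grid j, by simp only [ne_eq, Prod.mk.injEq]; omega,
        Or.inr (Or.inl ⟨rfl, Or.inl (by simp only; omega)⟩)⟩
    rintro (u | i) (v | j) ⟨-, huv⟩
    · exact foldCoord_adj (h.adj u v (huv.elim id fun h => h.symm))
    · exact (key j u (huv.resolve_left id)).symm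
    · exact key i v (huv.resolve_right id)
    · exact huv.elim (hor i j) fun hji => (hor j i hji).symm

lemma GP_exists_isDrawing (k p : ℕ) (hp : 0 < p) : ∃ c, (GP k p hp).IsDrawing (k + 1) c := by
  induction k generalizing p with
  | zero => exact ⟨_, baseRG_isDrawing hp⟩
  | succ k ih =>
    obtain ⟨c, hc⟩ := ih (2 * p) (by omega)
    exact ⟨_, stepRG_isDrawing (by omega) hp hc⟩

/-- Transports a solution of the Disjoint Paths Problem along an injective homomorphism to
`foldGraph k p`. -/
lemma exists_foldLinkage {V : Type*} {G : SimpleGraph V} {k p : ℕ} {s t : Fin k → V}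
    (f : G →g foldGraph k p) (hf : Function.Injective f) (hs : ∀ j, f (s j) = (2 ^ j.val, 1))
    (ht : ∀ j, f (t j) = if j.val + 1 = k then (2 ^ j.val, p) else (3 * 2 ^ j.val, 1))
    (h : HasDPPSolution G k s t) :
    ∃ L : FoldLinkage k p, ∀ l, ∀ x ∈ L.verts l, x ∈ Set.range f := by
  obtain ⟨P, -, hP⟩ := h
  have hsupp : ∀ j (hj : j < k) x,
      x ∈ (((P ⟨j, hj⟩).map f).copy (hs ⟨j, hj⟩) (ht ⟨j, hj⟩)).support ↔
        ∃ v ∈ (P ⟨j, hj⟩).support, f v = x := by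
    simp
  refine ⟨⟨fun j hj => ((P ⟨j, hj⟩).map f).copy (hs ⟨j, hj⟩) (ht ⟨j, hj⟩), ?_⟩, ?_⟩
  · intro i j hi hj hij x hx hx'
    obtain ⟨v, hv, rfl⟩ := (hsupp i hi x).1 hx
    obtain ⟨w, hw, hwv⟩ := (hsupp j hj _).1 hx'
    rw [hf hwv] at hw
    exact hP ⟨i, hi⟩ ⟨j, hj⟩ (by simpa using hij) v hv hw
  · rintro l x ⟨hl, hx⟩
    obtain ⟨v, -, rfl⟩ := (hsupp l hl x).1 hx
    exact ⟨v, rfl⟩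

lemma RowedGraph.IsDrawing.not_hasDPPSolution {k p : ℕ} (hk : 1 ≤ k) (hp : 1 ≤ p)
    {R : RowedGraph p} {c : R.V → ℕ × ℕ} (hc : R.IsDrawing k c) (v : R.V)
    (h : ∀ i : Fin k, v ≠ R.s i ∧ v ≠ R.t i) :
    ¬ HasDPPSolution (R.G.induce {u | u ≠ v}) k
      (fun i => ⟨R.s i, Ne.symm (h i).1⟩) (fun i => ⟨R.t i, Ne.symm (h i).2⟩) := by
  intro hsol
  let f : R.G.induce {u | u ≠ v} →g foldGraph k p := ⟨fun u => c u.1, fun h => hc.adj _ _ h⟩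
  obtain ⟨L, hL⟩ := exists_foldLinkage f (fun u w huw => Subtype.ext (hc.injective huw))
    (fun j => hc.source j j.isLt) (fun j => hc.target j j.isLt) hsol
  obtain ⟨l, hl⟩ := L.exists_mem_verts hk hp (hc.inGrid v)
  obtain ⟨u, hu⟩ := hL l _ hl
  exact u.2 (hc.injective hu)

lemma exists_walk_of_adj_succ {V : Type*} {G : SimpleGraph V} {p : ℕ} {y : Fin p → V}
    (hy : ∀ i j, i.val + 1 = j.val → G.Adj (y i) (y j)) (hp : 0 < p) (j : Fin p) :
    ∃ w : G.Walk (y ⟨0, hp⟩) (y j), ∀ v ∈ w.support, v ∈ Set.range y := by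
  obtain ⟨j, hj⟩ := j
  induction j with
  | zero => exact ⟨.nil, by simp⟩
  | succ j ih =>
    obtain ⟨w, hw⟩ := ih (by omega)
    refine ⟨w.concat (hy ⟨j, by omega⟩ ⟨j + 1, hj⟩ rfl), fun v hv => ?_⟩
    rw [Walk.support_concat, List.mem_append, List.mem_singleton] at hv
    exact hv.elim (hw v) fun h => h ▸ ⟨_, rfl⟩

lemma exists_walk_congr {V : Type*} {G : SimpleGraph V} {S : Set V} {a b a' b' : V} (ha : a' = a)
    (hb : b' = b) (h : ∃ w : G.Walk a b, ∀ v ∈ w.support, v ∈ S) :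
    ∃ w : G.Walk a' b', ∀ v ∈ w.support, v ∈ S := by
  subst ha hb
  exact h

/-- It suffices to find disjoint walks in order to solve the Disjoint Paths Problem. -/
lemma hasDPPSolution_of_walks {V : Type*} {G : SimpleGraph V} {k : ℕ} {s t : Fin k → V}
    (S : Fin k → Set V) (hS : ∀ i j, i ≠ j → Disjoint (S i) (S j))
    (h : ∀ i, ∃ w : G.Walk (s i) (t i), ∀ v ∈ w.support, v ∈ S i) : HasDPPSolution G k s t := by
  classical
  choose P hP using h
  refine ⟨fun i => (P i).bypass, fun i => (P i).bypass_isPath, fun i j hij v hi hj => ?_⟩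
  exact Set.disjoint_left.1 (hS i j hij) (hP i v ((P i).support_bypass_subset_support hi))
    (hP j v ((P j).support_bypass_subset_support hj))

lemma baseRG_hasDPPSolution {p : ℕ} (hp : 0 < p) :
    HasDPPSolution (baseRG p hp).G 1 (fun i => (baseRG p hp).s i) fun i => (baseRG p hp).t i := by
  refine hasDPPSolution_of_walks (fun _ => Set.univ)
    (fun i j hij => absurd (Subsingleton.elim i j) hij) fun _ => ?_
  have hy : ∀ i j : Fin p, i.val + 1 = j.val → (baseRG p hp).G.Adj i j := fun i j hij =>
    ⟨fun h => by simp [h] at hij, Or.inl hij⟩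
  obtain ⟨w, -⟩ := exists_walk_of_adj_succ (y := fun i : Fin p => i) hy hp ⟨p - 1, by omega⟩
  exact ⟨w, fun _ _ => trivial⟩

lemma stepRG_hasDPPSolution {k p : ℕ} (hp : 0 < p) {R : RowedGraph (2 * p)}
    (h : HasDPPSolution R.G k (fun i => R.s i) fun i => R.t i) :
    HasDPPSolution (stepRG k hp R).G (k + 1)
      (fun i => (stepRG k hp R).s i) fun i => (stepRG k hp R).t i := by
  obtain ⟨P, -, hP⟩ := h
  let f : R.G →g (stepRG k hp R).G :=
    ⟨Sum.inl, fun h => ⟨fun he => h.ne (Sum.inl_injective he), Or.inl h⟩⟩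
  have hy : ∀ i j : Fin p, i.val + 1 = j.val →
      (stepRG k hp R).G.Adj (Sum.inr i) (Sum.inr j) := fun i j hij =>
    ⟨fun h => by simp [Sum.inr_injective h] at hij, Or.inl hij⟩
  refine hasDPPSolution_of_walks (fun i => {v | if h : i.val < k then
    ∃ u ∈ (P ⟨i, h⟩).support, Sum.inl u = v else v ∈ Set.range Sum.inr}) ?_ ?_
  · intro i j hij
    rw [Set.disjoint_left]
    intro v hi hj
    simp only [Set.mem_ofPred_eq] at hi hj
    split_ifs at hi hj
    · obtain ⟨u, hu, rfl⟩ := hi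
      obtain ⟨w, hw, hwu⟩ := hj
      rw [Sum.inl_injective hwu] at hw
      exact hP _ _ (by simpa [Fin.ext_iff] using hij) u hu hw
    · obtain ⟨u, -, rfl⟩ := hi
      obtain ⟨w, hw⟩ := hj
      exact Sum.inr_ne_inl hw
    · obtain ⟨u, -, rfl⟩ := hj
      obtain ⟨w, hw⟩ := hi
      exact Sum.inr_ne_inl hw
    · omega
  · intro i
    by_cases hi : i.val < k
    · refine exists_walk_congr (if_pos hi) (if_pos hi) ⟨(P ⟨i, hi⟩).map f, fun v hv => ?_⟩
      rw [Walk.support_map, List.mem_map] at hv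
      rwa [Set.mem_ofPred_eq, dif_pos hi]
    · obtain ⟨w, hw⟩ := exists_walk_of_adj_succ (y := Sum.inr) hy hp ⟨p - 1, by omega⟩
      refine exists_walk_congr (if_neg hi) (if_neg hi) ⟨w, fun v hv => ?_⟩
      rw [Set.mem_ofPred_eq, dif_neg hi]
      exact hw v hv

lemma GP_hasDPPSolution (k p : ℕ) (hp : 0 < p) : HasDPPSolution (GP k p hp).G (k + 1)
    (fun i => (GP k p hp).s i) fun i => (GP k p hp).t i := by
  induction k generalizing p with
  | zero => exact baseRG_hasDPPSolution hp
  | succ k ih => exact stepRG_hasDPPSolution hp (ih (2 * p) (by omega))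

/-- For every `k ≥ 1`, the instance `G_k, (s_1,t_1), …, (s_k,t_k)` has a solution,
but for every non-terminal vertex `v`, the instance on `G_k - v` (with the same terminals) has
no solution; in particular no vertex is irrelevant. -/
theorem Gk_has_no_irrelevant_vertex (k : ℕ) (hk : 1 ≤ k) :
    let R := GP (k - 1) (2 ^ k - 1) (two_pow_sub_one_pos hk)
    HasDPPSolution R.G k (fun i => R.s i) (fun i => R.t i) ∧
      ∀ v : R.V, ∀ h : ∀ i : Fin k, v ≠ R.s i ∧ v ≠ R.t i,
        ¬ HasDPPSolution (R.G.induce {u | u ≠ v}) k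
            (fun i => ⟨R.s i, Ne.symm (h i).1⟩) (fun i => ⟨R.t i, Ne.symm (h i).2⟩) := by
  obtain ⟨k, rfl⟩ : ∃ m, k = m + 1 := ⟨k - 1, by omega⟩
  have hp := two_pow_sub_one_pos hk
  obtain ⟨c, hc⟩ := GP_exists_isDrawing k (2 ^ (k + 1) - 1) hp
  exact ⟨GP_hasDPPSolution k _ hp, fun v h => hc.not_hasDPPSolution hk hp v h⟩
end
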